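/- arXiv:1909.01508 — 5 statements merged into one kernel-verified Lean document; each statement's English description precedes it below -/
import Mathlib

section
/- For 0 < q < 1 and u real, the logarithm of the ratio θ₃(u/(2i), q)/θ₃(0, q) has the Taylor expansion 2·∑_{n≥1} (u^{2n}/(2n)!) · ∑_{k≥1} (-1)^{k+1} k^{2n-1} q^k/(1-q^{2k}). In particular, all odd Taylor coefficients vanish. -/
open Filter Topology Finset

/-- The Gaussian binomial coefficient at `Q`, defined by the `q`-Pascal recursion. -/
def gaussBinom (Q : ℝ) : ℕ → ℕ → ℝ
  | _, 0 => 1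
  | 0, _ + 1 => 0
  | n + 1, k + 1 => Q ^ (k + 1) * gaussBinom Q n (k + 1) + gaussBinom Q n k

/-- The finite `q`-Pochhammer symbol `(Q; Q)_n`. -/
def qPoch (Q : ℝ) (n : ℕ) : ℝ := ∏ i ∈ range n, (1 - Q ^ (i + 1))

lemma gaussBinom_zero_right (Q : ℝ) (n : ℕ) : gaussBinom Q n 0 = 1 := by
  cases n <;> simp [gaussBinom]

lemma gaussBinom_eq_zero_of_lt (Q : ℝ) {n k : ℕ} (h : n < k) : gaussBinom Q n k = 0 := by
  induction n generalizing k with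
  | zero => obtain ⟨k, rfl⟩ := Nat.exists_eq_succ_of_ne_zero (by omega : k ≠ 0); simp [gaussBinom]
  | succ n ih =>
    obtain ⟨k, rfl⟩ := Nat.exists_eq_succ_of_ne_zero (by omega : k ≠ 0)
    simp [gaussBinom, ih (show n < k + 1 by omega), ih (show n < k by omega)]

lemma gaussBinom_self (Q : ℝ) (n : ℕ) : gaussBinom Q n n = 1 := by
  induction n with
  | zero => simp [gaussBinom]
  | succ n ih => simp [gaussBinom, ih, gaussBinom_eq_zero_of_lt]

lemma qPoch_succ (Q : ℝ) (n : ℕ) : qPoch Q (n + 1) = qPoch Q n * (1 - Q ^ (n + 1)) :=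
  prod_range_succ _ _

lemma gaussBinom_mul_qPoch (Q : ℝ) (a b : ℕ) :
    gaussBinom Q (a + b) a * (qPoch Q a * qPoch Q b) = qPoch Q (a + b) := by
  suffices ∀ n a b, a + b = n →
      gaussBinom Q n a * (qPoch Q a * qPoch Q b) = qPoch Q n from this _ a b rfl
  intro n
  induction n with
  | zero =>
    intro a b h
    obtain ⟨rfl, rfl⟩ : a = 0 ∧ b = 0 := by omega
    simp [gaussBinom, qPoch]
  | succ n ih =>
    rintro (_ | a) (_ | b) h
    · omega
    · obtain rfl : b = n := by omega
      simp [gaussBinom_zero_right, qPoch]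
    · obtain rfl : a = n := by omega
      simp [gaussBinom_self, qPoch]
    · have h₁ := ih (a + 1) b (by omega)
      have h₂ := ih a (b + 1) (by omega)
      have hn : n = a + b + 1 := by omega
      rw [gaussBinom, qPoch_succ Q n]
      calc _ = Q ^ (a + 1) * (1 - Q ^ (b + 1)) *
              (gaussBinom Q n (a + 1) * (qPoch Q (a + 1) * qPoch Q b)) +
              (1 - Q ^ (a + 1)) * (gaussBinom Q n a * (qPoch Q a * qPoch Q (b + 1))) := by
            rw [qPoch_succ Q a, qPoch_succ Q b]; ring
        _ = _ := by rw [h₁, h₂, hn]; ring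

/-- The finite `q`-binomial theorem. -/
lemma prod_one_add_pow_mul (Q x : ℝ) (n : ℕ) :
    ∏ i ∈ range n, (1 + Q ^ i * x) =
      ∑ j ∈ range (n + 1), gaussBinom Q n j * Q ^ (j.choose 2) * x ^ j := by
  induction n generalizing x with
  | zero => simp [gaussBinom]
  | succ n ih =>
    have h : ∏ i ∈ range n, (1 + Q ^ (i + 1) * x) = ∏ i ∈ range n, (1 + Q ^ i * (Q * x)) :=
      prod_congr rfl fun i _ => by ring
    have hchoose (j : ℕ) : (j + 1).choose 2 = j + j.choose 2 := by
      simp [Nat.choose_succ_succ]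
    have hshift : ∑ j ∈ range (n + 1), gaussBinom Q n j * Q ^ (j.choose 2) * (Q * x) ^ j =
        1 + ∑ j ∈ range (n + 1),
          gaussBinom Q n (j + 1) * Q ^ ((j + 1).choose 2) * (Q * x) ^ (j + 1) := by
      rw [sum_range_succ', sum_range_succ _ n, gaussBinom_eq_zero_of_lt Q (Nat.lt_succ_self n)]
      simp [gaussBinom_zero_right, add_comm]
    rw [prod_range_succ', h, ih, sum_range_succ' _ (n + 1)]
    have hsplit : ∑ j ∈ range (n + 1),
          gaussBinom Q (n + 1) (j + 1) * Q ^ ((j + 1).choose 2) * x ^ (j + 1) =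
        (∑ j ∈ range (n + 1),
          gaussBinom Q n (j + 1) * Q ^ ((j + 1).choose 2) * (Q * x) ^ (j + 1)) +
        x * ∑ j ∈ range (n + 1), gaussBinom Q n j * Q ^ (j.choose 2) * (Q * x) ^ j := by
      rw [mul_sum, ← sum_add_distrib]
      refine sum_congr rfl fun j _ => ?_
      rw [gaussBinom, hchoose]
      ring
    rw [hsplit]
    simp only [gaussBinom_zero_right, Nat.choose_zero_succ, pow_zero, mul_one, one_mul]
    linear_combination hshift

/-- The finite Jacobi triple product identity. -/
lemma prod_finite_triple (q z : ℝ) (hq : 0 < q) (hz : 0 < z) (N : ℕ) :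
    ∏ m ∈ range N, ((1 + q ^ (2 * m + 1) * z) * (1 + q ^ (2 * m + 1) * z⁻¹)) =
      ∑ j ∈ range (2 * N + 1),
        gaussBinom (q ^ 2) (2 * N) j * (q ^ (((j : ℤ) - N).natAbs ^ 2) * z ^ ((j : ℤ) - N)) := by
  have key := prod_one_add_pow_mul (q ^ 2) (q * z / q ^ (2 * N)) (2 * N)
  have hleft : ∏ i ∈ range (2 * N), (1 + (q ^ 2) ^ i * (q * z / q ^ (2 * N))) =
      (z ^ N / q ^ (N ^ 2)) *
        ∏ m ∈ range N, ((1 + q ^ (2 * m + 1) * z) * (1 + q ^ (2 * m + 1) * z⁻¹)) := by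
    have hodd : z ^ N / q ^ (N ^ 2) = ∏ m ∈ range N, (z / q ^ (2 * m + 1)) := by
      rw [prod_div_distrib, prod_const, card_range, prod_pow_eq_pow_sum]
      have hN (n : ℕ) : n ^ 2 = ∑ i ∈ range n, (2 * i + 1) := by
        induction n with
        | zero => simp
        | succ n ih => rw [sum_range_succ, ← ih]; ring
      rw [← hN]
    rw [two_mul, prod_range_add,
      ← prod_range_reflect (fun i => 1 + (q ^ 2) ^ i * (q * z / q ^ (N + N))),
      prod_mul_distrib, hodd, mul_comm (∏ m ∈ range N, (1 + q ^ (2 * m + 1) * z)), ← mul_assoc]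
    congr 1
    · rw [← prod_mul_distrib]
      refine prod_congr rfl fun i hi => ?_
      obtain ⟨d, rfl⟩ : ∃ d, N = i + 1 + d := ⟨N - (i + 1), by have := mem_range.1 hi; omega⟩
      rw [show i + 1 + d - 1 - i = d by omega]
      field_simp
      ring
    · refine prod_congr rfl fun i _ => ?_
      field_simp
      ring
  rw [hleft] at key
  have hc : z ^ N / q ^ (N ^ 2) ≠ 0 := by positivity
  apply mul_left_cancel₀ hc
  rw [key, mul_sum]
  refine sum_congr rfl fun j hj => ?_
  clear hj
  have hexp : q ^ (((j : ℤ) - N).natAbs ^ 2) = q ^ (j ^ 2 + N ^ 2) / q ^ (2 * N * j) := by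
    rw [eq_div_iff (by positivity), ← pow_add]
    congr 1
    zify
    rw [sq_abs]
    ring
  have hch : (q ^ 2) ^ (j.choose 2) * q ^ j = q ^ (j ^ 2) := by
    rw [← pow_mul, ← pow_add]
    congr 1
    clear hexp
    induction j with
    | zero => simp
    | succ j ih =>
      have : (j + 1).choose 2 = j + j.choose 2 := by simp [Nat.choose_succ_succ]
      rw [this]
      linear_combination ih
  have hterm : (q ^ 2) ^ (j.choose 2) * (q * z / q ^ (2 * N)) ^ j =
      q ^ (j ^ 2) * z ^ j / q ^ (2 * N * j) := by
    rw [← hch, div_pow, mul_pow, pow_mul q (2 * N)]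
    ring
  rw [hexp, zpow_sub₀ hz.ne', zpow_natCast, zpow_natCast, mul_assoc, hterm, pow_add]
  field_simp

lemma qPoch_pos {Q : ℝ} (h0 : 0 < Q) (h1 : Q < 1) (n : ℕ) : 0 < qPoch Q n :=
  prod_pos fun i _ => sub_pos.2 (pow_lt_one₀ h0.le h1 (by omega))

lemma qPoch_antitone {Q : ℝ} (h0 : 0 < Q) (h1 : Q < 1) : Antitone (qPoch Q) :=
  antitone_nat_of_succ_le fun n => by
    rw [qPoch_succ]
    exact mul_le_of_le_one_right (qPoch_pos h0 h1 n).le (by linarith [pow_pos h0 (n + 1)])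

lemma exists_tendsto_qPoch {Q : ℝ} (h0 : 0 < Q) (h1 : Q < 1) :
    ∃ L > 0, Tendsto (qPoch Q) atTop (𝓝 L) := by
  have hs : Summable fun i : ℕ => -Q ^ (i + 1) :=
    ((summable_nat_add_iff 1).2 (summable_geometric_of_lt_one h0.le h1)).neg
  have hl := Real.summable_log_one_add_of_summable hs
  refine ⟨_, Real.exp_pos _, ((Real.continuous_exp.tendsto _).comp
    hl.hasSum.tendsto_sum_nat).congr fun n => ?_⟩
  rw [Function.comp_apply, Real.exp_sum, qPoch]
  refine prod_congr rfl fun i _ => ?_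
  rw [Real.exp_log, sub_eq_add_neg]
  linarith [pow_lt_one₀ h0.le h1 (show i + 1 ≠ 0 by omega)]

lemma summable_pow_sq_mul_pow {q r : ℝ} (h0 : 0 < q) (h1 : q < 1) (hr : 0 < r) :
    Summable fun n : ℕ => q ^ (n ^ 2) * r ^ n := by
  refine summable_of_ratio_test_tendsto_lt_one zero_lt_one
    (Eventually.of_forall fun n => by positivity) ?_
  have : Tendsto (fun n : ℕ => (q ^ 2) ^ n * (q * r)) atTop (𝓝 0) := by
    simpa using (tendsto_pow_atTop_nhds_zero_of_lt_one (by positivity)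
      (pow_lt_one₀ h0.le h1 two_ne_zero)).mul_const (q * r)
  refine this.congr fun n => ?_
  rw [Real.norm_of_nonneg (by positivity), Real.norm_of_nonneg (by positivity),
    eq_div_iff (by positivity)]
  ring

lemma summable_pow_sq_mul_zpow {q z : ℝ} (h0 : 0 < q) (h1 : q < 1) (hz : 0 < z) :
    Summable fun n : ℤ => q ^ (n.natAbs ^ 2) * z ^ n := by
  refine Summable.of_nat_of_neg ?_ ?_
  · simpa using summable_pow_sq_mul_pow h0 h1 hz
  · simpa using summable_pow_sq_mul_pow h0 h1 (inv_pos.2 hz)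

/-- The Jacobi triple product, up to its constant factor `L = (q²; q²)_∞`. -/
lemma tendsto_prod_triple {q L z : ℝ} (h0 : 0 < q) (h1 : q < 1) (hL : 0 < L)
    (hP : Tendsto (qPoch (q ^ 2)) atTop (𝓝 L)) (hz : 0 < z) :
    Tendsto (fun N => ∏ m ∈ range N,
      ((1 + q ^ (2 * m + 1) * z) * (1 + q ^ (2 * m + 1) * z⁻¹))) atTop
      (𝓝 (L⁻¹ * ∑' n : ℤ, q ^ (n.natAbs ^ 2) * z ^ n)) := by
  have hQ0 : 0 < q ^ 2 := by positivity
  have hQ1 : q ^ 2 < 1 := pow_lt_one₀ h0.le h1 two_ne_zero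
  have hpos := qPoch_pos hQ0 hQ1
  have hle (n : ℕ) : L ≤ qPoch (q ^ 2) n := (qPoch_antitone hQ0 hQ1).le_of_tendsto hP n
  have hbinom (N : ℕ) (n : ℤ) (hn : n.natAbs ≤ N) :
      gaussBinom (q ^ 2) (2 * N) (n + N).toNat =
        qPoch (q ^ 2) (2 * N) / (qPoch (q ^ 2) (n + N).toNat * qPoch (q ^ 2) (N - n).toNat) := by
    rw [eq_div_iff (mul_pos (hpos _) (hpos _)).ne']
    have := gaussBinom_mul_qPoch (q ^ 2) (n + N).toNat (N - n).toNat
    rwa [show (n + N).toNat + (N - n).toNat = 2 * N by omega] at this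
  set f : ℕ → ℤ → ℝ := fun N n => if n.natAbs ≤ N then
    gaussBinom (q ^ 2) (2 * N) (n + N).toNat * (q ^ (n.natAbs ^ 2) * z ^ n) else 0 with hf
  have hsum (N : ℕ) : ∑' n, f N n = ∏ m ∈ range N,
      ((1 + q ^ (2 * m + 1) * z) * (1 + q ^ (2 * m + 1) * z⁻¹)) := by
    rw [prod_finite_triple q z h0 hz,
      tsum_eq_sum (s := (range (2 * N + 1)).image fun j : ℕ => (j : ℤ) - N), sum_image]
    · refine sum_congr rfl fun j hj => ?_
      have := mem_range.1 hj
      simp only [hf]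
      rw [if_pos (by omega), show ((j : ℤ) - N + N).toNat = j by omega]
    · intro a _ b _ h
      simpa using h
    · intro n hn
      refine if_neg fun h => hn (mem_image.2 ⟨(n + N).toNat, mem_range.2 (by omega), by omega⟩)
  have hlim : Tendsto (fun N => ∑' n, f N n) atTop
      (𝓝 (∑' n : ℤ, L⁻¹ * (q ^ (n.natAbs ^ 2) * z ^ n))) := by
    refine tendsto_tsum_of_dominated_convergence
      ((summable_pow_sq_mul_zpow h0 h1 hz).mul_left L⁻¹) (fun n => ?_)
      (Eventually.of_forall fun N n => ?_)
    · have ha : Tendsto (fun N : ℕ => (n + N).toNat) atTop atTop :=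
        tendsto_atTop.2 fun b => (eventually_ge_atTop (b + n.natAbs)).mono fun N hN => by omega
      have hb : Tendsto (fun N : ℕ => (N - n).toNat) atTop atTop :=
        tendsto_atTop.2 fun b => (eventually_ge_atTop (b + n.natAbs)).mono fun N hN => by omega
      have hc : Tendsto (fun N : ℕ => 2 * N) atTop atTop :=
        tendsto_atTop.2 fun b => (eventually_ge_atTop b).mono fun N hN => by omega
      have := ((hP.comp hc).div ((hP.comp ha).mul (hP.comp hb)) (by positivity)).mul_const
        (q ^ (n.natAbs ^ 2) * z ^ n)
      rw [div_mul_cancel_left₀ hL.ne'] at this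
      refine this.congr' ((eventually_ge_atTop n.natAbs).mono fun N hN => ?_)
      simp only [hf]
      rw [if_pos hN, hbinom N n hN]
      rfl
    · simp only [hf]
      split_ifs with hN
      · rw [hbinom N n hN, Real.norm_of_nonneg
          (mul_nonneg (div_pos (hpos _) (mul_pos (hpos _) (hpos _))).le (by positivity))]
        refine mul_le_mul_of_nonneg_right ?_ (by positivity)
        rw [div_le_iff₀ (mul_pos (hpos _) (hpos _))]
        have h₁ : qPoch (q ^ 2) (2 * N) ≤ qPoch (q ^ 2) (n + N).toNat :=
          qPoch_antitone hQ0 hQ1 (by omega)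
        have h₂ := hle (N - n).toNat
        rw [inv_mul_eq_div, le_div_iff₀ hL]
        exact mul_le_mul h₁ h₂ hL.le (hpos _).le
      · rw [norm_zero]
        positivity
  rw [tsum_mul_left] at hlim
  exact hlim.congr hsum

lemma hasSum_log_one_add {x : ℝ} (hx : |x| < 1) :
    HasSum (fun k : ℕ => (-1) ^ k * x ^ (k + 1) / (k + 1)) (Real.log (1 + x)) := by
  have := (Real.hasSum_pow_div_log_of_abs_lt_one (x := -x) (by rwa [abs_neg])).neg
  rw [neg_neg, sub_neg_eq_add] at this
  refine this.congr_fun fun k => ?_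
  rw [neg_pow x]
  ring

lemma hasSum_cosh_sub_one (x : ℝ) :
    HasSum (fun n : ℕ => x ^ (2 * (n + 1)) / (Nat.factorial (2 * (n + 1)))) (Real.cosh x - 1) := by
  simpa using (hasSum_nat_add_iff' 1).2 (Real.hasSum_cosh x)

lemma cosh_sub_one_le (k : ℕ) (u : ℝ) :
    Real.cosh ((k + 1) * u) - 1 ≤ Real.exp |u| ^ (k + 1) := by
  rw [← Real.exp_nat_mul, ← Real.cosh_abs, abs_mul, Real.cosh_eq,
    abs_of_pos (by positivity : (0 : ℝ) < k + 1)]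
  have : Real.exp (-((k + 1) * |u|)) ≤ Real.exp ((k + 1) * |u|) :=
    Real.exp_le_exp.2 (by have : 0 ≤ (k + 1) * |u| := by positivity
                          linarith)
  push_cast
  linarith

/-- One factor of the logarithm of the triple product, as a power series in `t`. -/
lemma hasSum_log_factor {t u : ℝ} (ht : 0 < t) (h : t * Real.exp |u| < 1) :
    HasSum (fun k : ℕ => (-1) ^ k / (k + 1) * t ^ (k + 1) * (2 * (Real.cosh ((k + 1) * u) - 1)))
      (Real.log ((1 + t * Real.exp u) * (1 + t * (Real.exp u)⁻¹)) -
        Real.log ((1 + t * 1) * (1 + t * 1⁻¹))) := by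
  have hlt {v : ℝ} (hv : v ≤ |u|) : |t * Real.exp v| < 1 := by
    rw [abs_of_pos (by positivity)]
    exact (mul_le_mul_of_nonneg_left (Real.exp_le_exp.2 hv) ht.le).trans_lt h
  have h₁ := hasSum_log_one_add (hlt (le_abs_self u))
  have h₂ := hasSum_log_one_add (hlt (neg_le_abs u))
  have h₃ := hasSum_log_one_add (hlt (abs_nonneg u))
  rw [Real.exp_zero] at h₃
  rw [← Real.exp_neg, inv_one, Real.log_mul (by positivity) (by positivity),
    Real.log_mul (by positivity) (by positivity)]
  refine ((h₁.add h₂).sub (h₃.add h₃)).congr_fun fun k => ?_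
  rw [Real.cosh_eq, mul_pow, mul_pow, ← Real.exp_nat_mul, ← Real.exp_nat_mul]
  push_cast
  rw [mul_neg]
  ring

lemma mul_exp_abs_pow_lt_one {q u : ℝ} (h0 : 0 < q) (h1 : q < 1) (h : q * Real.exp |u| < 1)
    (m : ℕ) : q ^ (2 * m + 1) * Real.exp |u| < 1 :=
  (mul_le_mul_of_nonneg_right (pow_le_of_le_one h0.le h1.le (by omega))
    (Real.exp_pos _).le).trans_lt h

lemma abs_neg_one_pow_div_le (k : ℕ) : |(-1 : ℝ) ^ k / (k + 1)| ≤ 1 := by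
  rw [abs_div, abs_pow, abs_neg, abs_one, one_pow, abs_of_pos (by positivity)]
  exact div_le_one_of_le₀ (by linarith [k.cast_nonneg (α := ℝ)]) (by positivity)

lemma summable_log_factor_terms {q u : ℝ} (h0 : 0 < q) (h1 : q < 1) (h : q * Real.exp |u| < 1) :
    Summable fun p : ℕ × ℕ => (-1 : ℝ) ^ p.1 / (p.1 + 1) * (q ^ (2 * p.2 + 1)) ^ (p.1 + 1) *
      (2 * (Real.cosh ((p.1 + 1) * u) - 1)) := by
  have hr := ((summable_nat_add_iff 1).2
    (summable_geometric_of_lt_one (by positivity) h)).mul_left 2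
  have hQ := summable_geometric_of_lt_one (sq_nonneg q) (pow_lt_one₀ h0.le h1 two_ne_zero)
  refine Summable.of_norm_bounded (hr.mul_of_nonneg hQ (fun _ => by positivity)
    (fun _ => by positivity)) fun ⟨k, m⟩ => ?_
  have hc : 0 ≤ Real.cosh ((k + 1) * u) - 1 := sub_nonneg.2 (Real.one_le_cosh _)
  rw [Real.norm_eq_abs, abs_mul, abs_mul, abs_of_pos (pow_pos (pow_pos h0 _) _),
    abs_of_nonneg (mul_nonneg zero_le_two hc)]
  have hq : (q ^ (2 * m + 1)) ^ (k + 1) ≤ q ^ (k + 1) * (q ^ 2) ^ m := by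
    rw [← pow_mul, ← pow_mul, ← pow_add]
    exact pow_le_pow_of_le_one h0.le h1.le (by nlinarith [Nat.zero_le (m * k)])
  calc _ ≤ 1 * (q ^ (k + 1) * (q ^ 2) ^ m) * (2 * Real.exp |u| ^ (k + 1)) := by
        gcongr
        · exact abs_neg_one_pow_div_le k
        · exact cosh_sub_one_le k u
    _ = _ := by rw [mul_pow]; ring

lemma hasSum_odd_geometric {q : ℝ} (h0 : 0 < q) (h1 : q < 1) (k : ℕ) :
    HasSum (fun m : ℕ => (q ^ (2 * m + 1)) ^ (k + 1)) (q ^ (k + 1) / (1 - q ^ (2 * (k + 1)))) := by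
  have := (hasSum_geometric_of_lt_one (pow_pos h0 (2 * (k + 1))).le
    (pow_lt_one₀ h0.le h1 (by omega))).mul_left (q ^ (k + 1))
  rw [← div_eq_mul_inv] at this
  refine this.congr_fun fun m => ?_
  rw [← pow_mul, ← pow_mul, ← pow_add]
  congr 1
  ring

lemma summable_lambert_terms {q u : ℝ} (h0 : 0 < q) (h1 : q < 1) (h : q * Real.exp |u| < 1) :
    Summable fun p : ℕ × ℕ => (-1 : ℝ) ^ p.1 / (p.1 + 1) *
      (q ^ (p.1 + 1) / (1 - q ^ (2 * (p.1 + 1)))) *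
      (2 * (((p.1 + 1) * u) ^ (2 * (p.2 + 1)) / (Nat.factorial (2 * (p.2 + 1))))) := by
  have hcosh (k : ℕ) := (hasSum_cosh_sub_one ((k + 1) * u)).mul_left 2
  have hden (k : ℕ) : 0 < 1 - q ^ (2 * (k + 1)) :=
    sub_pos.2 (pow_lt_one₀ h0.le h1 (by omega))
  have hnorm (k n : ℕ) : ‖(-1 : ℝ) ^ k / (k + 1) * (q ^ (k + 1) / (1 - q ^ (2 * (k + 1)))) *
      (2 * (((k + 1) * u) ^ (2 * (n + 1)) / (Nat.factorial (2 * (n + 1)))))‖ =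
      |(-1 : ℝ) ^ k / (k + 1)| * (q ^ (k + 1) / (1 - q ^ (2 * (k + 1)))) *
      (2 * (((k + 1) * u) ^ (2 * (n + 1)) / (Nat.factorial (2 * (n + 1))))) := by
    have := hden k
    have hev : 0 ≤ ((k + 1) * u) ^ (2 * (n + 1)) := (even_two_mul _).pow_nonneg _
    rw [Real.norm_eq_abs, abs_mul, abs_mul, abs_of_nonneg (div_nonneg (pow_pos h0 _).le this.le),
      abs_of_nonneg (mul_nonneg zero_le_two (div_nonneg hev (Nat.cast_nonneg _)))]
  refine Summable.of_norm ((summable_prod_of_nonneg fun _ => norm_nonneg _).2 ⟨fun k => ?_, ?_⟩)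
  · simp only [hnorm]
    exact (hcosh k).summable.mul_left _
  · simp only [hnorm, tsum_mul_left, (hasSum_cosh_sub_one _).tsum_eq]
    have hr := ((summable_nat_add_iff 1).2
      (summable_geometric_of_lt_one (by positivity) h)).mul_left (2 / (1 - q ^ 2))
    have h2 : 0 < 1 - q ^ 2 := by simpa using hden 0
    refine Summable.of_nonneg_of_le (fun k => ?_) (fun k => ?_) hr
    · have := hden k
      have hc : 0 ≤ Real.cosh ((k + 1) * u) - 1 := sub_nonneg.2 (Real.one_le_cosh _)
      positivity
    · have := hden k
      have hc : 0 ≤ Real.cosh ((k + 1) * u) - 1 := sub_nonneg.2 (Real.one_le_cosh _)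
      calc _ ≤ 1 * (q ^ (k + 1) / (1 - q ^ 2)) * (2 * Real.exp |u| ^ (k + 1)) := by
            gcongr ?_ * (_ / (1 - ?_)) * (2 * ?_)
            · exact abs_neg_one_pow_div_le k
            · exact pow_le_pow_of_le_one h0.le h1.le (by omega)
            · exact cosh_sub_one_le k u
        _ = _ := by rw [mul_pow]; ring

/-- Two iterated sums of an absolutely summable double family agree. -/
lemma hasSum_of_hasSum_fiberwise {f : ℕ → ℕ → ℝ} (hf : Summable fun p : ℕ × ℕ => f p.1 p.2)
    {g h : ℕ → ℝ} {a : ℝ} (hg : ∀ m, HasSum (fun k => f k m) (g m))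
    (hh : ∀ k, HasSum (f k) (h k)) (ha : HasSum h a) : HasSum g a := by
  have := (hf.hasSum.prod_fiberwise hh).unique ha
  have hs : HasSum (fun p : ℕ × ℕ => f p.2 p.1) a := by
    rw [← this]
    exact (Equiv.prodComm ℕ ℕ).hasSum_iff.2 hf.hasSum
  exact hs.prod_fiberwise hg

/-- The logarithm of the triple product, normalised at `u = 0`, as a power series in `u`. -/
lemma hasSum_log_triple {q u : ℝ} (h0 : 0 < q) (h1 : q < 1) (h : q * Real.exp |u| < 1) :
    HasSum (fun m : ℕ =>
      Real.log ((1 + q ^ (2 * m + 1) * Real.exp u) * (1 + q ^ (2 * m + 1) * (Real.exp u)⁻¹)) -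
        Real.log ((1 + q ^ (2 * m + 1) * 1) * (1 + q ^ (2 * m + 1) * 1⁻¹)))
      (2 * ∑' n : ℕ, u ^ (2 * (n + 1)) / (Nat.factorial (2 * (n + 1))) *
          ∑' k : ℕ, (-1 : ℝ) ^ k * ((k : ℝ) + 1) ^ (2 * (n + 1) - 1) * q ^ (k + 1) /
            (1 - q ^ (2 * (k + 1)))) := by
  have hA := summable_log_factor_terms h0 h1 h
  have hB := summable_lambert_terms h0 h1 h
  refine hasSum_of_hasSum_fiberwise hA (fun m => hasSum_log_factor (pow_pos h0 (2 * m + 1))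
    (mul_exp_abs_pow_lt_one h0 h1 h m))
    (fun k => ((hasSum_odd_geometric h0 h1 k).mul_left _).mul_right _)
    (hasSum_of_hasSum_fiberwise (f := fun n k => (-1 : ℝ) ^ k / (k + 1) *
      (q ^ (k + 1) / (1 - q ^ (2 * (k + 1)))) *
      (2 * (((k + 1) * u) ^ (2 * (n + 1)) / (Nat.factorial (2 * (n + 1))))))
      hB.prod_symm (fun k => ((hasSum_cosh_sub_one _).mul_left 2).mul_left _)
      (fun n => (hB.prod_symm.prod_factor n).hasSum) ?_)
  rw [← tsum_mul_left]
  refine (congrArg (HasSum _) ?_).mp hB.prod_symm.prod.hasSum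
  symm
  refine tsum_congr fun n => ?_
  rw [← tsum_mul_left, ← tsum_mul_left]
  refine tsum_congr fun k => ?_
  simp only [Prod.swap]
  have : 2 * (n + 1) = (2 * (n + 1) - 1) + 1 := by omega
  rw [mul_pow, this, Nat.add_sub_cancel, pow_succ ((k : ℝ) + 1)]
  field_simp

theorem theta3_log_ratio_taylor (q : ℝ) (hq0 : 0 < q) (hq1 : q < 1) :
    ∃ ε > 0, ∀ u : ℝ, |u| < ε →
      Real.log ((∑' n : ℤ, q ^ (n.natAbs ^ 2) * Real.exp (n * u)) /
          (∑' n : ℤ, q ^ (n.natAbs ^ 2))) =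
        2 * ∑' n : ℕ, u ^ (2 * (n + 1)) / (Nat.factorial (2 * (n + 1))) *
          ∑' k : ℕ, (-1 : ℝ) ^ k * ((k : ℝ) + 1) ^ (2 * (n + 1) - 1) * q ^ (k + 1) /
            (1 - q ^ (2 * (k + 1))) := by
  refine ⟨-Real.log q, neg_pos.2 (Real.log_neg hq0 hq1), fun u hu => ?_⟩
  have h : q * Real.exp |u| < 1 := by
    rw [← Real.exp_log hq0, ← Real.exp_add, Real.exp_lt_one_iff]
    linarith
  obtain ⟨L, hL, hP⟩ := exists_tendsto_qPoch (pow_pos hq0 2) (pow_lt_one₀ hq0.le hq1 two_ne_zero)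
  have hpos {z : ℝ} (hz : 0 < z) : 0 < ∑' n : ℤ, q ^ (n.natAbs ^ 2) * z ^ n :=
    (summable_pow_sq_mul_zpow hq0 hq1 hz).tsum_pos (fun n => by positivity) 0 (by simp)
  have hu' := tendsto_prod_triple hq0 hq1 hL hP (Real.exp_pos u)
  have h1 := tendsto_prod_triple hq0 hq1 hL hP one_pos
  have hlim := (hu'.log (mul_pos (inv_pos.2 hL) (hpos (Real.exp_pos u))).ne').sub
    (h1.log (mul_pos (inv_pos.2 hL) (hpos one_pos)).ne')
  rw [← Real.log_div (mul_pos (inv_pos.2 hL) (hpos (Real.exp_pos u))).ne'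
    (mul_pos (inv_pos.2 hL) (hpos one_pos)).ne', mul_div_mul_left _ _ (inv_pos.2 hL).ne'] at hlim
  have hexp (n : ℤ) : Real.exp u ^ n = Real.exp (n * u) := by
    rw [mul_comm, Real.exp_mul, Real.rpow_intCast]
  simp only [one_zpow, mul_one, hexp] at hlim
  refine tendsto_nhds_unique hlim ((hasSum_log_triple hq0 hq1 h).tendsto_sum_nat.congr fun N => ?_)
  have hne (m : ℕ) {z : ℝ} (hz : 0 < z) :
      (1 + q ^ (2 * m + 1) * z) * (1 + q ^ (2 * m + 1) * z⁻¹) ≠ 0 := by positivity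
  rw [sum_sub_distrib, ← Real.log_prod fun m _ => hne m (Real.exp_pos u),
    ← Real.log_prod fun m _ => hne m one_pos]
  simp only [mul_one]
end

section
/- For 0 < q < 1 and n ≥ 1, the 2n-th cumulant of the discrete normal distribution with probability mass P(X = m) = q^{m²}/θ₃(q) for m ∈ ℤ equals 2·∑_{k≥1} (-1)^{k-1} k^{2n-1}/(q^{-k} - q^{k}), and all odd cumulants vanish. -/
open Real

open Filter Topology Finset

/-- The reciprocal `1 / (p; p)_n` of the `q`-Pochhammer symbol, extended by `0` to negative `n`. -/
noncomputable def qPochhammerInv (p : ℝ) (n : ℤ) : ℝ :=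
  if n < 0 then 0 else (∏ j ∈ range n.toNat, (1 - p ^ (j + 1)))⁻¹

lemma one_sub_pow_succ_pos {p : ℝ} (hp0 : 0 < p) (hp1 : p < 1) (j : ℕ) : 0 < 1 - p ^ (j + 1) :=
  sub_pos.2 (pow_lt_one₀ hp0.le hp1 j.succ_ne_zero)

lemma prod_one_sub_pow_pos {p : ℝ} (hp0 : 0 < p) (hp1 : p < 1) (n : ℕ) :
    0 < ∏ j ∈ range n, (1 - p ^ (j + 1)) :=
  prod_pos fun j _ ↦ one_sub_pow_succ_pos hp0 hp1 j

lemma qPochhammerInv_sub_one {p : ℝ} (hp0 : 0 < p) (hp1 : p < 1) (n : ℤ) :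
    qPochhammerInv p (n - 1) = (1 - p ^ n) * qPochhammerInv p n := by
  unfold qPochhammerInv
  rcases lt_trichotomy n 0 with h | rfl | h
  · rw [if_pos (by omega), if_pos h, mul_zero]
  · simp
  · obtain ⟨k, rfl⟩ : ∃ k : ℕ, n = (k + 1 : ℕ) := ⟨n.toNat - 1, by omega⟩
    have e : ((k + 1 : ℕ) : ℤ) - 1 = (k : ℕ) := by push_cast; ring
    rw [e, if_neg (by omega), if_neg (by omega), Int.toNat_natCast, Int.toNat_natCast,
      prod_range_succ, zpow_natCast]
    have h1 := (one_sub_pow_succ_pos hp0 hp1 k).ne'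
    have h2 := (prod_one_sub_pow_pos hp0 hp1 k).ne'
    field_simp

lemma qPochhammerInv_nonneg {p : ℝ} (hp0 : 0 < p) (hp1 : p < 1) (n : ℤ) :
    0 ≤ qPochhammerInv p n := by
  unfold qPochhammerInv
  split_ifs
  · exact le_rfl
  · exact (inv_pos.2 (prod_one_sub_pow_pos hp0 hp1 _)).le

lemma exists_tendsto_prod_one_sub_pow {p : ℝ} (hp0 : 0 < p) (hp1 : p < 1) :
    ∃ D > 0, Tendsto (fun n ↦ ∏ j ∈ range n, (1 - p ^ (j + 1))) atTop (𝓝 D) := by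
  have hs : Summable fun j : ℕ ↦ -p ^ (j + 1) :=
    ((summable_nat_add_iff 1).2 (summable_geometric_of_lt_one hp0.le hp1)).neg
  refine ⟨_, Real.exp_pos _,
    ((Real.continuous_exp.tendsto _).comp
      (Real.summable_log_one_add_of_summable hs).hasSum.tendsto_sum_nat).congr fun n ↦ ?_⟩
  simp only [Function.comp, Real.exp_sum]
  refine prod_congr rfl fun j _ ↦ ?_
  rw [← sub_eq_add_neg, Real.exp_log (one_sub_pow_succ_pos hp0 hp1 j)]

lemma exists_tendsto_qPochhammerInv {p : ℝ} (hp0 : 0 < p) (hp1 : p < 1) :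
    ∃ G > 0, (∀ n, qPochhammerInv p n ≤ G) ∧
      ∀ m : ℤ, Tendsto (fun N : ℕ ↦ qPochhammerInv p (N + m)) atTop (𝓝 G) := by
  obtain ⟨D, hD, h⟩ := exists_tendsto_prod_one_sub_pow hp0 hp1
  have hanti : Antitone fun n ↦ ∏ j ∈ range n, (1 - p ^ (j + 1)) := by
    refine antitone_nat_of_succ_le fun n ↦ ?_
    rw [prod_range_succ]
    exact mul_le_of_le_one_right (prod_one_sub_pow_pos hp0 hp1 n).le
      (sub_le_self _ (by positivity))
  refine ⟨D⁻¹, inv_pos.2 hD, fun n ↦ ?_, fun m ↦ ?_⟩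
  · unfold qPochhammerInv
    split_ifs
    · exact (inv_pos.2 hD).le
    · exact inv_anti₀ hD (hanti.le_of_tendsto h _)
  · have ht : Tendsto (fun N : ℕ ↦ ((N : ℤ) + m).toNat) atTop atTop := by
      refine tendsto_atTop.2 fun b ↦ ?_
      filter_upwards [eventually_ge_atTop (b + m.natAbs)] with N hN
      omega
    refine ((h.comp ht).inv₀ hD.ne').congr' ?_
    filter_upwards [eventually_ge_atTop m.natAbs] with N hN
    simp only [qPochhammerInv, Function.comp]
    rw [if_neg (by omega)]

/-- The coefficient of `z ^ m` in the finite form of the Jacobi triple product, up to a factor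
independent of `m`. -/
noncomputable def tripleCoeff (q : ℝ) (N : ℕ) (m : ℤ) : ℝ :=
  qPochhammerInv (q ^ 2) (N - m) * qPochhammerInv (q ^ 2) (N + m) * q ^ (m ^ 2)

lemma tripleCoeff_succ {q : ℝ} (hq0 : 0 < q) (hq1 : q < 1) (N : ℕ) (m : ℤ) :
    (1 - (q ^ 2) ^ (2 * N + 1)) * (1 - (q ^ 2) ^ (2 * N + 2)) * tripleCoeff q (N + 1) m =
      (1 + (q ^ (2 * N + 1)) ^ 2) * tripleCoeff q N m +
        q ^ (2 * N + 1) * (tripleCoeff q N (m - 1) + tripleCoeff q N (m + 1)) := by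
  have hp0 : 0 < q ^ 2 := by positivity
  have hp1 : q ^ 2 < 1 := pow_lt_one₀ hq0.le hq1 two_ne_zero
  have r := qPochhammerInv_sub_one hp0 hp1
  have a1 := r ((N : ℤ) + 1 - m)
  have a2 := r ((N : ℤ) - m)
  have b1 := r ((N : ℤ) + 1 + m)
  have b2 := r ((N : ℤ) + m)
  rw [show (N : ℤ) + 1 - m - 1 = N - m by ring] at a1
  rw [show (N : ℤ) + 1 + m - 1 = N + m by ring] at b1
  rw [a1] at a2
  rw [b1] at b2
  unfold tripleCoeff
  push_cast
  rw [show (N : ℤ) - (m - 1) = N + 1 - m by ring, show (N : ℤ) + (m - 1) = N + m - 1 by ring,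
    show (N : ℤ) - (m + 1) = N - m - 1 by ring, show (N : ℤ) + (m + 1) = N + 1 + m by ring,
    a2, b2, a1, b1, show (m - 1) ^ 2 = m ^ 2 - m - m + 1 by ring,
    show (m + 1) ^ 2 = m ^ 2 + m + m + 1 by ring]
  have hq := hq0.ne'
  have hp := hp0.ne'
  simp only [zpow_add₀ hq, zpow_sub₀ hq, zpow_add₀ hp, zpow_sub₀ hp, zpow_natCast, zpow_one]
  have e1 : (q ^ 2) ^ m = (q ^ m) ^ 2 := by
    rw [← zpow_natCast, ← zpow_natCast, zpow_comm]
  have e2 : (q ^ 2) ^ N = (q ^ N) ^ 2 := pow_right_comm q 2 N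
  have hy : q ^ m ≠ 0 := zpow_ne_zero _ hq
  have e3 : ((q ^ 2) ^ 2) ^ N = (q ^ N) ^ 4 := by ring
  simp only [pow_add, pow_mul, pow_one, e1, e2, e3]
  generalize q ^ m = y at *
  generalize q ^ N = x at *
  generalize q ^ (m ^ 2) = w at *
  field_simp
  ring

lemma hasSum_tripleCoeff {q : ℝ} (hq0 : 0 < q) (hq1 : q < 1) {z : ℝ} (hz : 0 < z) (N : ℕ) :
    HasSum (fun m : ℤ ↦ tripleCoeff q N m * z ^ m)
      (∏ j ∈ range N, (1 + z * q ^ (2 * j + 1)) * (1 + z⁻¹ * q ^ (2 * j + 1)) /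
        ((1 - (q ^ 2) ^ (2 * j + 1)) * (1 - (q ^ 2) ^ (2 * j + 2)))) := by
  have hp0 : 0 < q ^ 2 := by positivity
  have hp1 : q ^ 2 < 1 := pow_lt_one₀ hq0.le hq1 two_ne_zero
  induction N with
  | zero =>
    convert hasSum_single (f := fun m : ℤ ↦ tripleCoeff q 0 m * z ^ m) 0 fun m hm ↦ ?_ using 1
    · simp [tripleCoeff, qPochhammerInv]
    · rcases lt_or_gt_of_ne hm with h | h <;> simp [tripleCoeff, qPochhammerInv, h]
  | succ N ih =>
    have c1 := (one_sub_pow_succ_pos hp0 hp1 (2 * N)).ne'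
    have c2 := (one_sub_pow_succ_pos hp0 hp1 (2 * N + 1)).ne'
    rw [prod_range_succ]
    generalize (∏ j ∈ range N, (1 + z * q ^ (2 * j + 1)) * (1 + z⁻¹ * q ^ (2 * j + 1)) /
      ((1 - (q ^ 2) ^ (2 * j + 1)) * (1 - (q ^ 2) ^ (2 * j + 2)))) = S at *
    have h1 := ((Equiv.subRight (1 : ℤ)).hasSum_iff.2 ih).mul_left z
    have h2 := ((Equiv.addRight (1 : ℤ)).hasSum_iff.2 ih).mul_left z⁻¹
    have h3 := ((ih.mul_left (1 + (q ^ (2 * N + 1)) ^ 2)).add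
      ((h1.add h2).mul_left (q ^ (2 * N + 1)))).div_const
        ((1 - (q ^ 2) ^ (2 * N + 1)) * (1 - (q ^ 2) ^ (2 * N + 2)))
    have e : S * ((1 + z * q ^ (2 * N + 1)) * (1 + z⁻¹ * q ^ (2 * N + 1)) /
        ((1 - (q ^ 2) ^ (2 * N + 1)) * (1 - (q ^ 2) ^ (2 * N + 2)))) =
        ((1 + (q ^ (2 * N + 1)) ^ 2) * S + q ^ (2 * N + 1) * (z * S + z⁻¹ * S)) /
          ((1 - (q ^ 2) ^ (2 * N + 1)) * (1 - (q ^ 2) ^ (2 * N + 2))) := by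
      rw [mul_div_assoc']
      congr 1
      field_simp
      ring
    rw [e]
    refine Eq.subst (motive := fun f ↦ HasSum f _) (funext fun m ↦ ?_) h3
    rw [div_eq_iff (mul_ne_zero c1 c2)]
    simp only [Function.comp, Equiv.subRight_apply, Equiv.coe_addRight, zpow_sub₀ hz.ne',
      zpow_add₀ hz.ne', zpow_one]
    have := tripleCoeff_succ hq0 hq1 N m
    field_simp
    linear_combination -this

lemma summable_pow_sq_mul_zpow_s2 {q : ℝ} (hq0 : 0 < q) (hq1 : q < 1) {z : ℝ} (hz : 0 < z) :
    Summable fun m : ℤ ↦ q ^ (m ^ 2) * z ^ m := by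
  have key : ∀ w : ℝ, 0 < w → Summable fun n : ℕ ↦ q ^ (n ^ 2) * w ^ n := by
    intro w hw
    refine summable_of_ratio_test_tendsto_lt_one (l := 0) one_pos
      (Eventually.of_forall fun n ↦ by positivity) ?_
    have h : Tendsto (fun n : ℕ ↦ q * w * (q ^ 2) ^ n) atTop (𝓝 (q * w * 0)) :=
      (tendsto_pow_atTop_nhds_zero_of_lt_one (by positivity)
        (pow_lt_one₀ hq0.le hq1 two_ne_zero)).const_mul _
    rw [mul_zero] at h
    refine h.congr fun n ↦ ?_
    rw [Real.norm_of_nonneg (by positivity), Real.norm_of_nonneg (by positivity),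
      eq_div_iff (by positivity)]
    ring
  refine Summable.of_nat_of_neg ((key z hz).congr fun n ↦ ?_)
    ((key z⁻¹ (inv_pos.2 hz)).congr fun n ↦ ?_)
  · norm_cast
  · rw [neg_sq, zpow_neg, zpow_natCast, inv_pow]
    norm_cast

lemma tendsto_tsum_tripleCoeff {q : ℝ} (hq0 : 0 < q) (hq1 : q < 1) :
    ∃ C > 0, ∀ z > 0, Tendsto (fun N ↦ ∑' m : ℤ, tripleCoeff q N m * z ^ m) atTop
      (𝓝 (C * ∑' m : ℤ, q ^ (m ^ 2) * z ^ m)) := by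
  have hp0 : 0 < q ^ 2 := by positivity
  have hp1 : q ^ 2 < 1 := pow_lt_one₀ hq0.le hq1 two_ne_zero
  obtain ⟨G, hG, hle, hlim⟩ := exists_tendsto_qPochhammerInv hp0 hp1
  have h0 := qPochhammerInv_nonneg hp0 hp1
  refine ⟨G * G, by positivity, fun z hz ↦ ?_⟩
  have hs := (summable_pow_sq_mul_zpow_s2 hq0 hq1 hz).mul_left (G * G)
  rw [← tsum_mul_left]
  refine tendsto_tsum_of_dominated_convergence hs (fun m ↦ ?_)
    (Eventually.of_forall fun N m ↦ ?_)
  · simp only [tripleCoeff, sub_eq_add_neg, mul_assoc]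
    exact (hlim (-m)).mul ((hlim m).mul_const _)
  · have hw : 0 ≤ q ^ (m ^ 2) * z ^ m := by positivity
    rw [tripleCoeff, mul_assoc, Real.norm_of_nonneg
      (mul_nonneg (mul_nonneg (h0 _) (h0 _)) hw)]
    exact mul_le_mul_of_nonneg_right (mul_le_mul (hle _) (hle _) (h0 _) hG.le) hw

/-- The Jacobi triple product, normalised at `z = 1`. -/
lemma tendsto_prod_theta_ratio {q : ℝ} (hq0 : 0 < q) (hq1 : q < 1) {z : ℝ} (hz : 0 < z) :
    Tendsto (fun N ↦ ∏ j ∈ range N, (1 + z * q ^ (2 * j + 1)) * (1 + z⁻¹ * q ^ (2 * j + 1)) /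
        (1 + q ^ (2 * j + 1)) ^ 2) atTop
      (𝓝 ((∑' m : ℤ, q ^ (m ^ 2) * z ^ m) / ∑' m : ℤ, q ^ (m ^ 2))) := by
  obtain ⟨C, hC, h⟩ := tendsto_tsum_tripleCoeff hq0 hq1
  have hp0 : 0 < q ^ 2 := by positivity
  have hp1 : q ^ 2 < 1 := pow_lt_one₀ hq0.le hq1 two_ne_zero
  have hs := summable_pow_sq_mul_zpow_s2 hq0 hq1 one_pos
  have hpos : 0 < ∑' m : ℤ, q ^ (m ^ 2) * (1 : ℝ) ^ m :=
    hs.tsum_pos (fun m ↦ by positivity) 0 (by positivity)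
  have := (h z hz).div (h 1 one_pos) (mul_pos hC hpos).ne'
  rw [mul_div_mul_left _ _ hC.ne'] at this
  simp only [(hasSum_tripleCoeff hq0 hq1 hz _).tsum_eq,
    (hasSum_tripleCoeff hq0 hq1 one_pos _).tsum_eq] at this
  simp only [one_zpow, mul_one, inv_one, one_mul] at this
  refine this.congr fun N ↦ ?_
  rw [Pi.div_apply, ← prod_div_distrib]
  refine prod_congr rfl fun j _ ↦ ?_
  have c1 := (one_sub_pow_succ_pos hp0 hp1 (2 * j)).ne'
  have c2 := (one_sub_pow_succ_pos hp0 hp1 (2 * j + 1)).ne'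
  rw [div_div_div_cancel_right₀ (mul_ne_zero c1 c2), sq]

lemma two_mul_cosh_sub_two_nonneg (t : ℝ) : 0 ≤ 2 * Real.cosh t - 2 := by
  linarith [Real.one_le_cosh t]

lemma two_mul_cosh_sub_two_le (t : ℝ) : 2 * Real.cosh t - 2 ≤ 2 * Real.exp |t| := by
  rw [← Real.cosh_abs, Real.cosh_eq]
  linarith [Real.exp_le_exp.2 (neg_le_self (abs_nonneg t))]

lemma hasSum_two_mul_cosh_sub_two (t : ℝ) :
    HasSum (fun j : ℕ ↦ 2 * (t ^ (2 * (j + 1)) / (Nat.factorial (2 * (j + 1)) : ℝ)))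
      (2 * Real.cosh t - 2) := by
  have h := (hasSum_nat_add_iff' 1).2 (Real.hasSum_cosh t)
  have e : 2 * Real.cosh t - 2 = 2 * (Real.cosh t - ∑ i ∈ range 1,
      t ^ (2 * i) / (Nat.factorial (2 * i) : ℝ)) := by
    rw [sum_range_one]
    simp
    ring
  rw [e]
  exact h.mul_left 2

lemma hasSum_log_one_add_of_abs_lt_one {y : ℝ} (hy : |y| < 1) :
    HasSum (fun k : ℕ ↦ (-1) ^ k * (y ^ (k + 1) / (k + 1))) (Real.log (1 + y)) := by
  have h := (Real.hasSum_pow_div_log_of_abs_lt_one (x := -y) (by rwa [abs_neg])).neg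
  rw [neg_neg, sub_neg_eq_add] at h
  refine Eq.subst (motive := fun f ↦ HasSum f _) (funext fun k ↦ ?_) h
  rw [neg_pow]
  ring

lemma hasSum_log_theta_factor {x u : ℝ} (hx : 0 < x) (hxu : x * Real.exp |u| < 1) :
    HasSum (fun k : ℕ ↦ (-1) ^ k *
        (x ^ (k + 1) / (k + 1) * (2 * Real.cosh ((k + 1) * u) - 2)))
      (Real.log ((1 + Real.exp u * x) * (1 + (Real.exp u)⁻¹ * x) / (1 + x) ^ 2)) := by
  have hlt : ∀ v ≤ |u|, |Real.exp v * x| < 1 := fun v hv ↦ by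
    rw [abs_of_pos (by positivity), mul_comm]
    exact (mul_le_mul_of_nonneg_left (Real.exp_le_exp.2 hv) hx.le).trans_lt hxu
  have h0 := hlt 0 (abs_nonneg u)
  rw [Real.exp_zero, one_mul] at h0
  have h := ((hasSum_log_one_add_of_abs_lt_one (hlt u (le_abs_self u))).add
    (hasSum_log_one_add_of_abs_lt_one (hlt (-u) (neg_le_abs u)))).sub
    ((hasSum_log_one_add_of_abs_lt_one h0).mul_left 2)
  rw [← Real.exp_neg, Real.log_div (by positivity) (by positivity),
    Real.log_mul (by positivity) (by positivity), Real.log_pow]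
  refine Eq.subst (motive := fun f ↦ HasSum f _) (funext fun k ↦ ?_) h
  rw [Real.cosh_eq, mul_pow, mul_pow, ← Real.exp_nat_mul, ← Real.exp_nat_mul]
  push_cast
  rw [mul_neg]
  ring

lemma hasSum_odd_pow {q : ℝ} (hq0 : 0 < q) (hq1 : q < 1) (k : ℕ) :
    HasSum (fun n : ℕ ↦ (q ^ (2 * n + 1)) ^ (k + 1))
      (1 / (q ^ (-((k : ℤ) + 1)) - q ^ ((k : ℤ) + 1))) := by
  have hlt : q ^ (k + 1) < 1 := pow_lt_one₀ hq0.le hq1 k.succ_ne_zero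
  have h := (hasSum_geometric_of_lt_one (r := (q ^ (k + 1)) ^ 2) (by positivity)
    (pow_lt_one₀ (by positivity) hlt two_ne_zero)).mul_left (q ^ (k + 1))
  have e : ((k : ℤ) + 1) = ((k + 1 : ℕ) : ℤ) := by push_cast; rfl
  rw [e, zpow_neg, zpow_natCast]
  have hne : 1 - (q ^ (k + 1)) ^ 2 ≠ 0 :=
    (sub_pos.2 (pow_lt_one₀ (by positivity) hlt two_ne_zero)).ne'
  have e2 : 1 / ((q ^ (k + 1))⁻¹ - q ^ (k + 1)) =
      q ^ (k + 1) * (1 - (q ^ (k + 1)) ^ 2)⁻¹ := by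
    have hp : q ^ (k + 1) ≠ 0 := by positivity
    generalize q ^ (k + 1) = y at *
    have : y⁻¹ - y = (1 - y ^ 2) / y := by field_simp
    rw [this]
    field_simp
  rw [e2]
  refine Eq.subst (motive := fun f ↦ HasSum f _) (funext fun n ↦ ?_) h
  rw [← pow_mul, ← pow_mul, ← pow_mul, ← pow_add]
  ring

lemma summable_theta_factors {q u : ℝ} (hq0 : 0 < q) (hq1 : q < 1)
    (hu : q * Real.exp |u| < 1) :
    Summable fun x : ℕ × ℕ ↦ (q ^ (2 * x.1 + 1)) ^ (x.2 + 1) / (x.2 + 1) *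
      (2 * Real.cosh ((x.2 + 1) * u) - 2) := by
  have h1 : Summable fun n : ℕ ↦ (q ^ 2) ^ n :=
    summable_geometric_of_lt_one (by positivity) (pow_lt_one₀ hq0.le hq1 two_ne_zero)
  have h2 : Summable fun k : ℕ ↦ 2 * (q * Real.exp |u|) ^ (k + 1) :=
    ((summable_nat_add_iff 1).2 (summable_geometric_of_lt_one (by positivity) hu)).mul_left 2
  refine Summable.of_nonneg_of_le
    (fun x ↦ mul_nonneg (by positivity) (two_mul_cosh_sub_two_nonneg _)) ?_
    (h1.mul_of_nonneg h2 (fun n ↦ by positivity) (fun k ↦ by positivity))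
  rintro ⟨n, k⟩
  have b1 : (q ^ (2 * n + 1)) ^ (k + 1) / (k + 1) ≤ (q ^ 2) ^ n * q ^ (k + 1) := by
    calc (q ^ (2 * n + 1)) ^ (k + 1) / (k + 1) ≤ (q ^ (2 * n + 1)) ^ (k + 1) :=
          div_le_self (by positivity) (by linarith [k.cast_nonneg (α := ℝ)])
      _ = q ^ (2 * n * k + (2 * n + (k + 1))) := by rw [← pow_mul]; ring_nf
      _ ≤ q ^ (2 * n + (k + 1)) := pow_le_pow_of_le_one hq0.le hq1.le (Nat.le_add_left _ _)
      _ = (q ^ 2) ^ n * q ^ (k + 1) := by rw [pow_add, pow_mul]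
  have b2 : 2 * Real.cosh ((k + 1) * u) - 2 ≤ 2 * Real.exp |u| ^ (k + 1) := by
    refine (two_mul_cosh_sub_two_le _).trans_eq ?_
    rw [← Real.exp_nat_mul, abs_mul, abs_of_nonneg (by positivity : (0 : ℝ) ≤ k + 1)]
    push_cast
    rfl
  refine (mul_le_mul b1 b2 (two_mul_cosh_sub_two_nonneg _) (by positivity)).trans_eq ?_
  simp only [mul_pow]
  ring

lemma hasSum_theta_factors {q : ℝ} (hq0 : 0 < q) (hq1 : q < 1) (u : ℝ) (k : ℕ) :
    HasSum (fun n : ℕ ↦ (q ^ (2 * n + 1)) ^ (k + 1) / (k + 1) *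
        (2 * Real.cosh ((k + 1) * u) - 2))
      (1 / (q ^ (-((k : ℤ) + 1)) - q ^ ((k : ℤ) + 1)) / (k + 1) *
        (2 * Real.cosh ((k + 1) * u) - 2)) :=
  ((hasSum_odd_pow hq0 hq1 k).div_const _).mul_right _

lemma hasSum_log_theta_ratio {q u : ℝ} (hq0 : 0 < q) (hq1 : q < 1)
    (hu : q * Real.exp |u| < 1) :
    HasSum (fun k : ℕ ↦ (-1) ^ k * (1 / (q ^ (-((k : ℤ) + 1)) - q ^ ((k : ℤ) + 1)) / (k + 1) *
        (2 * Real.cosh ((k + 1) * u) - 2)))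
      (Real.log ((∑' m : ℤ, q ^ (m ^ 2) * Real.exp u ^ m) / ∑' m : ℤ, q ^ (m ^ 2))) := by
  have hs : Summable fun x : ℕ × ℕ ↦ (-1) ^ x.2 * ((q ^ (2 * x.1 + 1)) ^ (x.2 + 1) / (x.2 + 1) *
      (2 * Real.cosh ((x.2 + 1) * u) - 2)) := by
    refine Summable.of_abs ((summable_theta_factors hq0 hq1 hu).abs.congr fun x ↦ ?_)
    rw [abs_mul ((-1) ^ x.2), abs_pow, abs_neg, abs_one, one_pow, one_mul]
  obtain ⟨S, hS⟩ := hs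
  have hx : ∀ n : ℕ, q ^ (2 * n + 1) * Real.exp |u| < 1 := fun n ↦ by
    refine (mul_le_mul_of_nonneg_right ?_ (Real.exp_pos _).le).trans_lt hu
    exact pow_le_of_le_one hq0.le hq1.le (Nat.succ_ne_zero _)
  have hrow : HasSum (fun n : ℕ ↦ Real.log ((1 + Real.exp u * q ^ (2 * n + 1)) *
      (1 + (Real.exp u)⁻¹ * q ^ (2 * n + 1)) / (1 + q ^ (2 * n + 1)) ^ 2)) S :=
    HasSum.prod_fiberwise hS fun n ↦
      hasSum_log_theta_factor (x := q ^ (2 * n + 1)) (by positivity) (hx n)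
  have hcol : HasSum (fun k : ℕ ↦ (-1) ^ k *
      (1 / (q ^ (-((k : ℤ) + 1)) - q ^ ((k : ℤ) + 1)) / (k + 1) *
        (2 * Real.cosh ((k + 1) * u) - 2))) S :=
    HasSum.prod_fiberwise ((Equiv.prodComm ℕ ℕ).hasSum_iff.2 hS) fun k ↦
      (hasSum_theta_factors hq0 hq1 u k).mul_left ((-1) ^ k)
  have hpos : 0 < (∑' m : ℤ, q ^ (m ^ 2) * Real.exp u ^ m) / ∑' m : ℤ, q ^ (m ^ 2) := by
    have h1 := summable_pow_sq_mul_zpow_s2 hq0 hq1 one_pos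
    simp only [one_zpow, mul_one] at h1
    exact div_pos ((summable_pow_sq_mul_zpow_s2 hq0 hq1 (Real.exp_pos u)).tsum_pos
      (fun m ↦ by positivity) 0 (by positivity)) (h1.tsum_pos (fun m ↦ by positivity) 0
      (by positivity))
  have hlim := (tendsto_prod_theta_ratio hq0 hq1 (Real.exp_pos u)).log hpos.ne'
  have hsum := hrow.tendsto_sum_nat
  have hlog : ∀ N : ℕ, ∑ n ∈ range N, Real.log ((1 + Real.exp u * q ^ (2 * n + 1)) *
      (1 + (Real.exp u)⁻¹ * q ^ (2 * n + 1)) / (1 + q ^ (2 * n + 1)) ^ 2) =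
      Real.log (∏ n ∈ range N, (1 + Real.exp u * q ^ (2 * n + 1)) *
        (1 + (Real.exp u)⁻¹ * q ^ (2 * n + 1)) / (1 + q ^ (2 * n + 1)) ^ 2) := fun N ↦
    (Real.log_prod fun j _ ↦ by positivity).symm
  simp only [hlog] at hsum
  rw [tendsto_nhds_unique hlim hsum]
  exact hcol

/-- The cumulant generating function of the discrete normal distribution, expanded in powers of
the argument. -/
lemma log_theta_ratio_eq_tsum {q u : ℝ} (hq0 : 0 < q) (hq1 : q < 1)
    (hu : q * Real.exp |u| < 1) :
    Real.log ((∑' m : ℤ, q ^ (m ^ 2) * Real.exp u ^ m) / ∑' m : ℤ, q ^ (m ^ 2)) =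
      ∑' n : ℕ, (2 * ∑' k : ℕ, (-1 : ℝ) ^ k * ((k : ℝ) + 1) ^ (2 * (n + 1) - 1) /
          (q ^ (-((k : ℤ) + 1)) - q ^ ((k : ℤ) + 1))) *
        u ^ (2 * (n + 1)) / (Nat.factorial (2 * (n + 1))) := by
  set w : ℕ → ℝ := fun k ↦ 1 / (q ^ (-((k : ℤ) + 1)) - q ^ ((k : ℤ) + 1))
  have hw0 : ∀ k, 0 ≤ w k := fun k ↦ (hasSum_odd_pow hq0 hq1 k).nonneg fun n ↦ by positivity
  have hfib : ∀ k : ℕ, HasSum (fun j : ℕ ↦ w k / (k + 1) *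
      (2 * ((((k : ℝ) + 1) * u) ^ (2 * (j + 1)) / (Nat.factorial (2 * (j + 1)) : ℝ))))
      (w k / (k + 1) * (2 * Real.cosh ((k + 1) * u) - 2)) :=
    fun k ↦ (hasSum_two_mul_cosh_sub_two _).mul_left _
  have habs : Summable fun x : ℕ × ℕ ↦ w x.1 / (x.1 + 1) *
      (2 * ((((x.1 : ℝ) + 1) * u) ^ (2 * (x.2 + 1)) / (Nat.factorial (2 * (x.2 + 1)) : ℝ))) := by
    refine (summable_prod_of_nonneg fun x ↦ ?_).2 ⟨fun k ↦ (hfib k).summable, ?_⟩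
    · have := hw0 x.1
      have : 0 ≤ (((x.1 : ℝ) + 1) * u) ^ (2 * (x.2 + 1)) := (even_two_mul _).pow_nonneg _
      simp only [Pi.zero_apply]
      positivity
    · simp only [(hfib _).tsum_eq]
      obtain ⟨S, hS⟩ := summable_theta_factors hq0 hq1 hu
      exact (HasSum.prod_fiberwise ((Equiv.prodComm ℕ ℕ).hasSum_iff.2 hS)
        fun k ↦ hasSum_theta_factors hq0 hq1 u k).summable
  have hs : Summable (Function.uncurry fun k j : ℕ ↦ (-1 : ℝ) ^ k * (w k / (k + 1) *
      (2 * ((((k : ℝ) + 1) * u) ^ (2 * (j + 1)) / (Nat.factorial (2 * (j + 1)) : ℝ))))) := by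
    refine habs.abs.of_norm_bounded fun x ↦ ?_
    rw [Function.uncurry, Real.norm_eq_abs, abs_mul, abs_pow, abs_neg, abs_one, one_pow, one_mul]
  rw [← (hasSum_log_theta_ratio hq0 hq1 hu).tsum_eq]
  calc _ = ∑' k : ℕ, ∑' j : ℕ, (-1 : ℝ) ^ k * (w k / (k + 1) *
        (2 * ((((k : ℝ) + 1) * u) ^ (2 * (j + 1)) / (Nat.factorial (2 * (j + 1)) : ℝ)))) :=
        tsum_congr fun k ↦ ((hfib k).mul_left _).tsum_eq.symm
    _ = _ := hs.tsum_comm.symm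
    _ = _ := by
      refine tsum_congr fun j ↦ ?_
      rw [← tsum_mul_left, ← tsum_mul_right, ← tsum_div_const]
      refine tsum_congr fun k ↦ ?_
      have hk : (k : ℝ) + 1 ≠ 0 := by positivity
      rw [show 2 * (j + 1) - 1 = 2 * j + 1 by omega, div_eq_mul_one_div (_ * _) (_ - _),
        mul_pow, show 2 * (j + 1) = 2 * j + 1 + 1 by ring, pow_succ ((k : ℝ) + 1)]
      change _ = 2 * (_ * w k) * _ / _
      field_simp

/-- The cumulants of the discrete normal distribution `P(X = m) = q^{m²}/θ₃(q)` :
the cumulant generating function has Taylor expansion whose even coefficients are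
`κ_{2n} = 2 ∑_{k≥1} (-1)^{k-1} k^{2n-1}/(q^{-k} - q^{k})` and all odd coefficients vanish. -/
theorem theta3_cumulants (q : ℝ) (hq0 : 0 < q) (hq1 : q < 1) :
    ∃ ε > 0, ∀ u : ℝ, |u| < ε →
      Real.log ((∑' m : ℤ, Real.exp (m * u) * q ^ (m.natAbs ^ 2)) /
          (∑' m : ℤ, q ^ (m.natAbs ^ 2))) =
        ∑' n : ℕ, (2 * ∑' k : ℕ, (-1 : ℝ) ^ k * ((k : ℝ) + 1) ^ (2 * (n + 1) - 1) /
            (q ^ (-((k : ℤ) + 1)) - q ^ ((k : ℤ) + 1))) *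
          u ^ (2 * (n + 1)) / (Nat.factorial (2 * (n + 1))) := by
  have hl : 0 < -Real.log q := neg_pos.2 (Real.log_neg hq0 hq1)
  refine ⟨-Real.log q, hl, fun u hu ↦ ?_⟩
  have hqu : q * Real.exp |u| < 1 := by
    rw [← Real.exp_log hq0, ← Real.exp_add, Real.exp_lt_one_iff]
    linarith
  have hpow : ∀ m : ℤ, q ^ (m.natAbs ^ 2) = q ^ (m ^ 2) := fun m ↦ by
    rw [← Int.natAbs_sq, ← zpow_natCast]
    norm_cast
  rw [← log_theta_ratio_eq_tsum hq0 hq1 hqu]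
  have hexp : ∀ m : ℤ, Real.exp (m * u) * q ^ (m ^ 2) = q ^ (m ^ 2) * Real.exp u ^ m := fun m ↦ by
    rw [mul_comm, mul_comm (m : ℝ), Real.exp_mul, Real.rpow_intCast]
  simp only [hpow, hexp]
end

section
/- The second moment (variance) of the discrete normal distribution with parameter q = e^{-π K'(k)/K(k)} equals σ² = (K(k)²/π²)·(E(k)/K(k) − (1−k²)), i.e., (1/θ₃(q)) ∑_{p∈ℤ} p² q^{p²} = (K(k)²/π²)·(E(k)/K(k) − k'²). -/
open Real

/-- Complete elliptic integral of the first kind. -/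
noncomputable def ellipticK (k : ℝ) : ℝ :=
  ∫ t in (0:ℝ)..1, 1 / (Real.sqrt (1 - t ^ 2) * Real.sqrt (1 - k ^ 2 * t ^ 2))

/-- Complete elliptic integral of the second kind. -/
noncomputable def ellipticE (k : ℝ) : ℝ :=
  ∫ t in (0:ℝ)..1, Real.sqrt (1 - k ^ 2 * t ^ 2) / Real.sqrt (1 - t ^ 2)

section

open Set MeasureTheory Filter Topology intervalIntegral

/-- Gauss's integral `∫₀^{π/2} dθ / √(a² cos² θ + b² sin² θ)`. -/
noncomputable def gaussIntegral (a b : ℝ) : ℝ :=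
  ∫ θ in (0:ℝ)..(π / 2), (√(a ^ 2 * cos θ ^ 2 + b ^ 2 * sin θ ^ 2))⁻¹

lemma image_sin_Ioo_zero_pi_div_two : sin '' Ioo 0 (π / 2) = Ioo 0 1 := by
  ext y
  constructor
  · rintro ⟨x, ⟨h0, h1⟩, rfl⟩
    refine ⟨sin_pos_of_pos_of_lt_pi h0 (by linarith [pi_pos]), ?_⟩
    rw [← sin_pi_div_two]
    exact sin_lt_sin_of_lt_of_le_pi_div_two (by linarith [pi_pos]) le_rfl h1
  · rintro ⟨h0, h1⟩
    exact ⟨arcsin y, ⟨arcsin_pos.2 h0, arcsin_lt_pi_div_two.2 h1⟩,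
      sin_arcsin (by linarith) h1.le⟩

lemma image_tan_Ioo_zero_pi_div_two : tan '' Ioo 0 (π / 2) = Ioi 0 := by
  ext y
  constructor
  · rintro ⟨x, ⟨h0, h1⟩, rfl⟩
    exact tan_pos_of_pos_of_lt_pi_div_two h0 h1
  · intro h0
    exact ⟨arctan y, ⟨arctan_pos.2 h0, arctan_lt_pi_div_two y⟩, tan_arctan y⟩

lemma integral_div_sqrt_one_sub_sq (f : ℝ → ℝ) :
    ∫ t in (0:ℝ)..1, f t / √(1 - t ^ 2) = ∫ θ in (0:ℝ)..(π / 2), f (sin θ) := by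
  rw [integral_of_le zero_le_one, integral_of_le (by positivity), integral_Ioc_eq_integral_Ioo,
    integral_Ioc_eq_integral_Ioo, ← image_sin_Ioo_zero_pi_div_two,
    integral_image_eq_integral_abs_deriv_smul measurableSet_Ioo
      (fun x _ => (hasDerivAt_sin x).hasDerivWithinAt)
      (injOn_sin.mono (Ioo_subset_Icc_self.trans
        (Icc_subset_Icc (by linarith [pi_pos]) le_rfl)))]
  refine setIntegral_congr_fun measurableSet_Ioo fun x hx => ?_
  have hc : 0 < cos x := cos_pos_of_mem_Ioo ⟨by linarith [hx.1, pi_pos], hx.2⟩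
  have : √(1 - sin x ^ 2) = cos x := by
    rw [← cos_sq', sqrt_sq hc.le]
  simp only [this, abs_of_pos hc, smul_eq_mul]
  field_simp

lemma gaussIntegral_eq_integral_Ioi {a b : ℝ} (hb : 0 < b) :
    gaussIntegral a b = ∫ t in Ioi (0:ℝ), (√((a ^ 2 + t ^ 2) * (b ^ 2 + t ^ 2)))⁻¹ := by
  have himg : (fun θ => b * tan θ) '' Ioo 0 (π / 2) = Ioi 0 := by
    rw [← image_image (fun x => b * x) tan, image_tan_Ioo_zero_pi_div_two,
      image_mul_left_Ioi hb, mul_zero]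
  have hmem : ∀ x ∈ Ioo 0 (π / 2), x ∈ Ioo (-(π / 2)) (π / 2) :=
    fun x hx => ⟨by linarith [hx.1, pi_pos], hx.2⟩
  rw [gaussIntegral, integral_of_le (by positivity), integral_Ioc_eq_integral_Ioo, ← himg,
    integral_image_eq_integral_abs_deriv_smul measurableSet_Ioo
      (fun x hx => ((hasDerivAt_tan_of_mem_Ioo (hmem x hx)).const_mul b).hasDerivWithinAt)
      (fun x hx y hy h => injOn_tan (hmem x hx) (hmem y hy) (mul_left_cancel₀ hb.ne' h))]
  refine setIntegral_congr_fun measurableSet_Ioo fun x hx => ?_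
  have hc : 0 < cos x := cos_pos_of_mem_Ioo (hmem x hx)
  have h1 : (a ^ 2 + (b * tan x) ^ 2) * (b ^ 2 + (b * tan x) ^ 2) =
      (a ^ 2 * cos x ^ 2 + b ^ 2 * sin x ^ 2) * (b / cos x ^ 2) ^ 2 := by
    rw [tan_eq_sin_div_cos]
    field_simp
    rw [cos_sq_add_sin_sq, mul_one]
  simp only [smul_eq_mul]
  rw [h1, sqrt_mul' _ (by positivity), sqrt_sq (by positivity), abs_of_pos (by positivity)]
  field_simp

lemma integral_eq_two_mul_gaussIntegral {a b : ℝ} (hb : 0 < b) :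
    ∫ t : ℝ, (√((a ^ 2 + t ^ 2) * (b ^ 2 + t ^ 2)))⁻¹ = 2 * gaussIntegral a b := by
  rw [gaussIntegral_eq_integral_Ioi hb, ← integral_comp_abs]
  simp

/-- Gauss's invariance under one step of the arithmetic-geometric mean. -/
lemma gaussIntegral_agm {a b : ℝ} (ha : 0 < a) (hb : 0 < b) :
    gaussIntegral ((a + b) / 2) (√(a * b)) = gaussIntegral a b := by
  have hab : 0 < a * b := mul_pos ha hb
  have himg : (fun t => (t - a * b / t) / 2) '' Ioi 0 = univ := by
    refine eq_univ_of_forall fun u => ?_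
    have hs : |u| < √(u ^ 2 + a * b) := by
      rw [← sqrt_sq_eq_abs]; exact sqrt_lt_sqrt (sq_nonneg u) (by linarith)
    have hpos : 0 < u + √(u ^ 2 + a * b) := by linarith [neg_abs_le u]
    refine ⟨u + √(u ^ 2 + a * b), hpos, ?_⟩
    have := sq_sqrt (show 0 ≤ u ^ 2 + a * b by positivity)
    simp only
    field_simp
    linarith
  have hder : ∀ t ∈ Ioi (0:ℝ), HasDerivWithinAt (fun t => (t - a * b / t) / 2)
      ((1 + a * b / t ^ 2) / 2) (Ioi 0) t := by
    intro t ht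
    have ht' : t ≠ 0 := ne_of_gt ht
    have := (((hasDerivAt_id t).sub ((hasDerivAt_inv ht').const_mul (a * b))).div_const 2)
    refine (this.congr_deriv ?_).hasDerivWithinAt
    ring
  have hinj : InjOn (fun t => (t - a * b / t) / 2) (Ioi 0) := by
    refine StrictMonoOn.injOn fun x hx y hy hxy => ?_
    have : a * b / y < a * b / x := div_lt_div_of_pos_left hab hx hxy
    change (x - a * b / x) / 2 < (y - a * b / y) / 2
    linarith
  have key : 2 * gaussIntegral ((a + b) / 2) (√(a * b)) = 2 * gaussIntegral a b := by
    rw [← integral_eq_two_mul_gaussIntegral (sqrt_pos.2 hab), ← setIntegral_univ, ← himg,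
      integral_image_eq_integral_abs_deriv_smul measurableSet_Ioi hder hinj,
      gaussIntegral_eq_integral_Ioi hb, ← MeasureTheory.integral_const_mul]
    refine setIntegral_congr_fun measurableSet_Ioi fun t ht => ?_
    have ht : 0 < t := ht
    have h1 : (((a + b) / 2) ^ 2 + ((t - a * b / t) / 2) ^ 2) *
        (√(a * b) ^ 2 + ((t - a * b / t) / 2) ^ 2) =
        ((a ^ 2 + t ^ 2) * (b ^ 2 + t ^ 2)) * ((1 + a * b / t ^ 2) / 4) ^ 2 := by
      rw [sq_sqrt hab.le]
      field_simp
      ring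
    simp only [smul_eq_mul]
    rw [h1, sqrt_mul' _ (by positivity), sqrt_sq (by positivity), abs_of_pos (by positivity)]
    field_simp
    ring
  linarith

/-- The complete elliptic integral of the first kind as a function of the parameter `m = k²`. -/
noncomputable def legendreK (m : ℝ) : ℝ := ∫ θ in (0:ℝ)..(π / 2), (√(1 - m * sin θ ^ 2))⁻¹

/-- The complete elliptic integral of the second kind as a function of the parameter `m = k²`. -/
noncomputable def legendreE (m : ℝ) : ℝ := ∫ θ in (0:ℝ)..(π / 2), √(1 - m * sin θ ^ 2)

lemma ellipticK_eq_legendreK (k : ℝ) : ellipticK k = legendreK (k ^ 2) := by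
  rw [ellipticK, legendreK, ← integral_div_sqrt_one_sub_sq fun t => (√(1 - k ^ 2 * t ^ 2))⁻¹]
  congr 1 with t
  rw [one_div, mul_inv, mul_comm, div_eq_mul_inv]

lemma ellipticE_eq_legendreE (k : ℝ) : ellipticE k = legendreE (k ^ 2) := by
  rw [ellipticE, legendreE, ← integral_div_sqrt_one_sub_sq fun t => √(1 - k ^ 2 * t ^ 2)]

lemma gaussIntegral_eq_legendreK {a b : ℝ} (ha : 0 < a) :
    gaussIntegral a b = a⁻¹ * legendreK (1 - (b / a) ^ 2) := by
  rw [gaussIntegral, legendreK, ← intervalIntegral.integral_const_mul]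
  congr 1 with θ
  rw [show a ^ 2 * cos θ ^ 2 + b ^ 2 * sin θ ^ 2 =
      a ^ 2 * (1 - (1 - (b / a) ^ 2) * sin θ ^ 2) by rw [cos_sq']; field_simp; ring,
    sqrt_mul (sq_nonneg a), sqrt_sq ha.le, mul_inv]

lemma one_sub_mul_sin_sq_pos {m : ℝ} (hm : m < 1) (θ : ℝ) : 0 < 1 - m * sin θ ^ 2 := by
  rcases (sq_nonneg (sin θ)).eq_or_lt with h | h
  · simp [← h]
  · nlinarith [sin_sq_le_one θ]

lemma hasDerivAt_intervalIntegral_of_continuousOn {F F' : ℝ → ℝ → ℝ} {s : Set ℝ} (hs : IsOpen s)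
    {a b x₀ : ℝ} (hx₀ : x₀ ∈ s) (hF : ∀ x ∈ s, Continuous (F x))
    (hF' : ContinuousOn (Function.uncurry F') (s ×ˢ univ))
    (hderiv : ∀ x ∈ s, ∀ t, HasDerivAt (fun x => F x t) (F' x t) x) :
    HasDerivAt (fun x => ∫ t in a..b, F x t) (∫ t in a..b, F' x₀ t) x₀ := by
  obtain ⟨ε, hε, hball⟩ := Metric.nhds_basis_closedBall.mem_iff.1 (hs.mem_nhds hx₀)
  have hcpt : IsCompact (Metric.closedBall x₀ ε ×ˢ uIcc a b) :=
    (isCompact_closedBall x₀ ε).prod isCompact_uIcc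
  obtain ⟨C, hC⟩ := hcpt.exists_bound_of_continuousOn
    (hF'.mono (prod_mono hball (subset_univ _)))
  have hF'x : Continuous (F' x₀) := by
    rw [← continuousOn_univ]
    exact hF'.comp (f := fun t => (x₀, t)) (by fun_prop) fun t _ => ⟨hx₀, mem_univ t⟩
  refine (hasDerivAt_integral_of_dominated_loc_of_deriv_le (bound := fun _ => C)
    (Metric.closedBall_mem_nhds x₀ hε) ?_ ((hF x₀ hx₀).intervalIntegrable a b)
    hF'x.aestronglyMeasurable ?_ intervalIntegrable_const ?_).2
  · filter_upwards [hs.mem_nhds hx₀] with x hx using (hF x hx).aestronglyMeasurable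
  · exact .of_forall fun t ht x hx => hC (x, t) ⟨hx, uIoc_subset_uIcc ht⟩
  · exact .of_forall fun t ht x hx => hderiv x (hball hx) t

lemma continuous_inv_sqrt_one_sub {m : ℝ} (hm : m < 1) :
    Continuous fun θ => (√(1 - m * sin θ ^ 2))⁻¹ :=
  Continuous.inv₀ (by fun_prop) fun θ => (sqrt_pos.2 (one_sub_mul_sin_sq_pos hm θ)).ne'

lemma legendreK_pos {m : ℝ} (hm : m < 1) : 0 < legendreK m :=
  intervalIntegral_pos_of_pos ((continuous_inv_sqrt_one_sub hm).intervalIntegrable _ _)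
    (fun θ => inv_pos.2 (sqrt_pos.2 (one_sub_mul_sin_sq_pos hm θ))) (by positivity)

lemma legendreE_eq_integral_inv_pow {m : ℝ} (hm : m < 1) :
    legendreE m = (1 - m) * ∫ θ in (0:ℝ)..(π / 2), (√(1 - m * sin θ ^ 2))⁻¹ ^ 3 := by
  have hder : ∀ θ, HasDerivAt (fun θ => m * (sin θ * cos θ * (√(1 - m * sin θ ^ 2))⁻¹))
      (√(1 - m * sin θ ^ 2) - (1 - m) * (√(1 - m * sin θ ^ 2))⁻¹ ^ 3) θ := by
    intro θ
    have hp := one_sub_mul_sin_sq_pos hm θ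
    have h1 : HasDerivAt (fun θ => 1 - m * sin θ ^ 2) (-(m * (2 * sin θ * cos θ))) θ := by
      simpa using (((hasDerivAt_sin θ).pow 2).const_mul m).const_sub 1
    have h2 := (((hasDerivAt_sin θ).mul (hasDerivAt_cos θ)).mul
      ((h1.sqrt hp.ne').inv (sqrt_pos.2 hp).ne')).const_mul m
    refine h2.congr_deriv ?_
    have hs := sq_sqrt hp.le
    have hs0 := (sqrt_pos.2 hp)
    have hc := cos_sq' θ
    simp only [Pi.mul_apply, Pi.inv_apply]
    generalize √(1 - m * sin θ ^ 2) = w at hs hs0 ⊢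
    field_simp
    rw [hc]
    generalize sin θ ^ 2 = x at *
    linear_combination (m - 2 * m * x - w ^ 2 - (1 - m * x)) * hs
  have hi : Continuous fun θ => (√(1 - m * sin θ ^ 2))⁻¹ := continuous_inv_sqrt_one_sub hm
  have h := integral_eq_sub_of_hasDerivAt (a := 0) (b := π / 2) (fun θ _ => hder θ)
    (Continuous.intervalIntegrable (by fun_prop) _ _)
  rw [intervalIntegral.integral_sub (Continuous.intervalIntegrable (by fun_prop) _ _)
    (Continuous.intervalIntegrable (by fun_prop) _ _),
    intervalIntegral.integral_const_mul] at h
  simp only [cos_pi_div_two, sin_zero, mul_zero, zero_mul, sub_zero] at h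
  rw [legendreE]
  linarith

lemma hasDerivAt_legendreK' {m : ℝ} (hm : m < 1) :
    HasDerivAt legendreK
      (∫ θ in (0:ℝ)..(π / 2), sin θ ^ 2 / 2 * (√(1 - m * sin θ ^ 2))⁻¹ ^ 3) m := by
  refine hasDerivAt_intervalIntegral_of_continuousOn isOpen_Iio (mem_Iio.2 hm)
    (F' := fun m θ => sin θ ^ 2 / 2 * (√(1 - m * sin θ ^ 2))⁻¹ ^ 3)
    (fun x hx => continuous_inv_sqrt_one_sub hx) ?_ fun x hx θ => ?_
  · refine ContinuousOn.mul (by fun_prop) (ContinuousOn.pow (ContinuousOn.inv₀ (by fun_prop) ?_) 3)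
    rintro ⟨x, θ⟩ ⟨hx, -⟩
    exact (sqrt_pos.2 (one_sub_mul_sin_sq_pos hx θ)).ne'
  · have hp := one_sub_mul_sin_sq_pos hx θ
    have h1 : HasDerivAt (fun x => 1 - x * sin θ ^ 2) (-sin θ ^ 2) x := by
      simpa using ((hasDerivAt_id x).mul_const (sin θ ^ 2)).const_sub 1
    refine ((h1.sqrt hp.ne').inv (sqrt_pos.2 hp).ne').congr_deriv ?_
    have := sqrt_pos.2 hp
    field_simp

lemma hasDerivAt_legendreK {m : ℝ} (hm0 : m ≠ 0) (hm : m < 1) :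
    HasDerivAt legendreK ((legendreE m - (1 - m) * legendreK m) / (2 * m * (1 - m))) m := by
  refine (hasDerivAt_legendreK' hm).congr_deriv ?_
  have hi : Continuous fun θ => (√(1 - m * sin θ ^ 2))⁻¹ := continuous_inv_sqrt_one_sub hm
  have hm1 : 1 - m ≠ 0 := by linarith
  rw [legendreE_eq_integral_inv_pow hm, ← mul_sub, legendreK,
    ← intervalIntegral.integral_sub (Continuous.intervalIntegrable (by fun_prop) _ _)
      (Continuous.intervalIntegrable (by fun_prop) _ _), mul_comm, mul_div_mul_right _ _ hm1,
    ← intervalIntegral.integral_div]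
  congr 1 with θ
  have hp := one_sub_mul_sin_sq_pos hm θ
  have hs := sq_sqrt hp.le
  have hs0 := (sqrt_pos.2 hp)
  generalize √(1 - m * sin θ ^ 2) = w at hs hs0 ⊢
  field_simp
  linarith

lemma hasDerivAt_legendreE {m : ℝ} (hm0 : m ≠ 0) (hm : m < 1) :
    HasDerivAt legendreE ((legendreE m - legendreK m) / (2 * m)) m := by
  have hi : Continuous fun θ => (√(1 - m * sin θ ^ 2))⁻¹ := continuous_inv_sqrt_one_sub hm
  have h : HasDerivAt legendreE
      (∫ θ in (0:ℝ)..(π / 2), -(sin θ ^ 2 / 2) * (√(1 - m * sin θ ^ 2))⁻¹) m := by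
    refine hasDerivAt_intervalIntegral_of_continuousOn isOpen_Iio (mem_Iio.2 hm)
      (F' := fun m θ => -(sin θ ^ 2 / 2) * (√(1 - m * sin θ ^ 2))⁻¹)
      (fun x hx => by fun_prop) ?_ fun x hx θ => ?_
    · refine ContinuousOn.mul (by fun_prop) (ContinuousOn.inv₀ (by fun_prop) ?_)
      rintro ⟨x, θ⟩ ⟨hx, -⟩
      exact (sqrt_pos.2 (one_sub_mul_sin_sq_pos hx θ)).ne'
    · have hp := one_sub_mul_sin_sq_pos hx θ
      have h1 : HasDerivAt (fun x => 1 - x * sin θ ^ 2) (-sin θ ^ 2) x := by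
        simpa using ((hasDerivAt_id x).mul_const (sin θ ^ 2)).const_sub 1
      refine (h1.sqrt hp.ne').congr_deriv ?_
      have := sqrt_pos.2 hp
      field_simp
  refine h.congr_deriv ?_
  rw [legendreE, legendreK,
    ← intervalIntegral.integral_sub (Continuous.intervalIntegrable (by fun_prop) _ _)
      (Continuous.intervalIntegrable (by fun_prop) _ _), ← intervalIntegral.integral_div]
  congr 1 with θ
  have hp := one_sub_mul_sin_sq_pos hm θ
  have hs := sq_sqrt hp.le
  have hs0 := (sqrt_pos.2 hp)
  generalize √(1 - m * sin θ ^ 2) = w at hs hs0 ⊢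
  field_simp
  linarith

lemma continuous_legendreE : Continuous legendreE :=
  continuous_parametric_intervalIntegral_of_continuous' (by fun_prop) _ _

lemma legendreK_zero : legendreK 0 = π / 2 := by simp [legendreK]

lemma legendreE_one : legendreE 1 = 1 := by
  rw [legendreE, integral_congr (g := cos), integral_cos]
  · simp
  · intro θ hθ
    rw [uIcc_of_le (by positivity)] at hθ
    simp only [one_mul, ← cos_sq']
    exact sqrt_sq (cos_nonneg_of_mem_Icc ⟨by linarith [hθ.1, pi_pos], hθ.2⟩)

lemma legendreK_le {m : ℝ} (hm0 : 0 ≤ m) (hm : m < 1) : legendreK m ≤ π / 2 / √(1 - m) := by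
  have : legendreK m ≤ ∫ θ in (0:ℝ)..(π / 2), (√(1 - m))⁻¹ := by
    refine integral_mono_on (by positivity)
      ((continuous_inv_sqrt_one_sub hm).intervalIntegrable _ _) intervalIntegrable_const
      fun θ _ => ?_
    have : 0 < √(1 - m) := sqrt_pos.2 (by linarith)
    gcongr
    nlinarith [sin_sq_le_one θ]
  simpa [div_eq_mul_inv] using this

/-- Legendre's relation. -/
lemma legendre_relation {m : ℝ} (hm : m ∈ Ioo 0 1) :
    legendreE m * legendreK (1 - m) + legendreE (1 - m) * legendreK m
      - legendreK m * legendreK (1 - m) = π / 2 := by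
  set L : ℝ → ℝ := fun m => legendreE m * legendreK (1 - m) + legendreE (1 - m) * legendreK m
      - legendreK m * legendreK (1 - m) with hL
  have hder : ∀ x ∈ Ioo (0:ℝ) 1, HasDerivAt L 0 x := by
    intro x ⟨h0, h1⟩
    have h0' : 1 - x ≠ 0 := by linarith
    have hsub : HasDerivAt (fun x : ℝ => 1 - x) (-1) x := by
      simpa using (hasDerivAt_id x).const_sub 1
    have K := hasDerivAt_legendreK h0.ne' h1
    have E := hasDerivAt_legendreE h0.ne' h1
    have K' := (hasDerivAt_legendreK h0' (by linarith)).comp x hsub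
    have E' := (hasDerivAt_legendreE h0' (by linarith)).comp x hsub
    refine (((E.mul K').add (E'.mul K)).sub (K.mul K')).congr_deriv ?_
    simp only [Function.comp_apply]
    have h3 : 1 - (1 - x) = x := by ring
    rw [h3]
    have := h0.ne'
    field_simp
    ring
  have hlim : Tendsto L (𝓝[>] 0) (𝓝 (π / 2)) := by
    have hsub : Tendsto (fun x : ℝ => 1 - x) (𝓝[>] 0) (𝓝 1) :=
      tendsto_nhdsWithin_of_tendsto_nhds (Continuous.tendsto' (by fun_prop) _ _ (by simp))
    have hK : Tendsto legendreK (𝓝[>] 0) (𝓝 (π / 2)) := by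
      rw [← legendreK_zero]
      exact tendsto_nhdsWithin_of_tendsto_nhds (hasDerivAt_legendreK' one_pos).continuousAt
    have hE' : Tendsto (fun x => legendreE (1 - x)) (𝓝[>] 0) (𝓝 1) := by
      have := (continuous_legendreE.tendsto 1).comp hsub
      rwa [legendreE_one] at this
    have hKE : Tendsto (fun x => (legendreK x - legendreE x) * legendreK (1 - x))
        (𝓝[>] 0) (𝓝 0) := by
      have hb : Tendsto (fun x => √x * legendreK x * (π / 2)) (𝓝[>] 0) (𝓝 0) := by
        have h0 : Tendsto (fun x : ℝ => √x) (𝓝[>] 0) (𝓝 0) :=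
          tendsto_nhdsWithin_of_tendsto_nhds (Continuous.tendsto' (by fun_prop) _ _ (by simp))
        simpa using (h0.mul hK).mul_const (π / 2)
      refine squeeze_zero' ?_ ?_ hb
      all_goals
        filter_upwards [Ioo_mem_nhdsGT one_pos] with x hx
        have hi : Continuous fun θ => (√(1 - x * sin θ ^ 2))⁻¹ := continuous_inv_sqrt_one_sub hx.2
        have hdiff : legendreK x - legendreE x =
            ∫ θ in (0:ℝ)..(π / 2), x * sin θ ^ 2 * (√(1 - x * sin θ ^ 2))⁻¹ := by
          rw [legendreE, legendreK,
            ← intervalIntegral.integral_sub (Continuous.intervalIntegrable (by fun_prop) _ _)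
            (Continuous.intervalIntegrable (by fun_prop) _ _)]
          congr 1 with θ
          have hp := one_sub_mul_sin_sq_pos hx.2 θ
          have hs := sq_sqrt hp.le
          have hs0 := (sqrt_pos.2 hp)
          field_simp
          linarith
        have hpos : 0 < legendreK (1 - x) := legendreK_pos (by linarith [hx.1])
      · have : 0 ≤ legendreK x - legendreE x := by
          rw [hdiff]
          refine integral_nonneg (by positivity) fun θ _ => ?_
          have := hx.1
          positivity
        positivity
      · have h1 : legendreK x - legendreE x ≤ x * legendreK x := by
          rw [hdiff, legendreK, ← intervalIntegral.integral_const_mul]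
          refine integral_mono_on (by positivity) (Continuous.intervalIntegrable (by fun_prop) _ _)
            (Continuous.intervalIntegrable (by fun_prop) _ _) fun θ _ => ?_
          have := hx.1
          gcongr
          nlinarith [sin_sq_le_one θ]
        have h2 := legendreK_le (m := 1 - x) (by linarith [hx.2]) (by linarith [hx.1])
        rw [show 1 - (1 - x) = x by ring] at h2
        have hxs : √x * √x = x := mul_self_sqrt hx.1.le
        have hs0 : 0 < √x := sqrt_pos.2 hx.1
        have hK0 := legendreK_pos hx.2
        calc (legendreK x - legendreE x) * legendreK (1 - x)
            ≤ (x * legendreK x) * (π / 2 / √x) := by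
              have := hx.1
              gcongr
          _ = √x * legendreK x * (π / 2) := by
              nth_rewrite 1 [← hxs]
              field_simp
    have := (hE'.mul hK).sub hKE
    simp only [one_mul, sub_zero] at this
    refine this.congr fun x => ?_
    simp only [hL]
    ring
  have hconst : ∀ x ∈ Ioo (0:ℝ) 1, L x = L m := fun x hx =>
    isOpen_Ioo.is_const_of_deriv_eq_zero isPreconnected_Ioo
      (fun y hy => (hder y hy).differentiableAt.differentiableWithinAt)
      (fun y hy => (hder y hy).deriv) hx hm
  refine tendsto_nhds_unique (tendsto_const_nhds.congr' ?_) hlim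
  filter_upwards [Ioo_mem_nhdsGT one_pos] with x hx using (hconst x hx).symm

/-- The theta function `∑ εⁿ exp (-π s n²)`; `ε = 1` and `ε = -1` give Jacobi's `θ₃` and `θ₄`. -/
noncomputable def realTheta (ε s : ℝ) : ℝ := ∑' n : ℤ, ε ^ n * exp (-π * s * n ^ 2)

lemma summable_sq_mul_exp {s : ℝ} (hs : 0 < s) (k : ℕ) :
    Summable fun n : ℤ => |(n : ℝ)| ^ k * exp (-π * s * n ^ 2) := by
  refine (summable_pow_mul_jacobiTheta₂_term_bound 0 hs k).congr fun n => ?_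
  push_cast
  ring_nf

lemma summable_exp_neg_pi_mul {s : ℝ} (hs : 0 < s) :
    Summable fun n : ℤ => exp (-π * s * n ^ 2) := by
  simpa using summable_sq_mul_exp hs 0

lemma abs_zpow_eq_one {ε : ℝ} (hε : |ε| = 1) (n : ℤ) : |ε ^ n| = 1 := by
  rw [abs_zpow, hε, one_zpow]

lemma summable_norm_realTheta {ε s : ℝ} (hε : |ε| = 1) (hs : 0 < s) :
    Summable fun n : ℤ => ‖ε ^ n * exp (-π * s * n ^ 2)‖ := by
  refine (summable_exp_neg_pi_mul hs).congr fun n => ?_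
  rw [norm_mul, norm_eq_abs, abs_zpow_eq_one hε, one_mul, norm_of_nonneg (exp_pos _).le]

lemma hasDerivAt_realTheta {ε s : ℝ} (hε : |ε| = 1) (hs : 0 < s) :
    HasDerivAt (realTheta ε) (∑' n : ℤ, ε ^ n * (exp (-π * s * n ^ 2) * (-π * n ^ 2))) s := by
  have hs2 : 0 < s / 2 := by positivity
  refine hasDerivAt_tsum_of_isPreconnected (t := Ioi (s / 2)) (y₀ := s)
    (u := fun n : ℤ => π * (|(n : ℝ)| ^ 2 * exp (-π * (s / 2) * n ^ 2)))
    (g' := fun n y => ε ^ n * (exp (-π * y * n ^ 2) * (-π * n ^ 2)))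
    ((summable_sq_mul_exp hs2 2).mul_left π) isOpen_Ioi isPreconnected_Ioi ?_ ?_
    (half_lt_self hs) (summable_norm_realTheta hε hs).of_norm (half_lt_self hs)
  · intro n y _
    have h : HasDerivAt (fun y : ℝ => -π * y * n ^ 2) (-π * n ^ 2) y := by
      simpa using ((hasDerivAt_id y).const_mul (-π)).mul_const ((n : ℝ) ^ 2)
    exact h.exp.const_mul _
  · intro n y hy
    have hy : s / 2 < y := hy
    rw [norm_mul, norm_eq_abs, abs_zpow_eq_one hε, one_mul, norm_mul, norm_mul, norm_neg,
      norm_of_nonneg (exp_pos _).le, norm_of_nonneg pi_pos.le, norm_of_nonneg (sq_nonneg _),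
      sq_abs]
    have : exp (-π * y * n ^ 2) ≤ exp (-π * (s / 2) * n ^ 2) := by
      rw [exp_le_exp]
      have := mul_le_mul_of_nonneg_left hy.le (mul_nonneg pi_pos.le (sq_nonneg (n : ℝ)))
      linarith
    calc exp (-π * y * n ^ 2) * (π * n ^ 2) ≤ exp (-π * (s / 2) * n ^ 2) * (π * n ^ 2) := by gcongr
      _ = _ := by ring

lemma tendsto_realTheta_atTop {ε : ℝ} (hε : |ε| = 1) :
    Tendsto (realTheta ε) atTop (𝓝 1) := by
  have hsum : ∑' n : ℤ, (if n = 0 then (1 : ℝ) else 0) = 1 := tsum_ite_eq 0 _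
  rw [← hsum]
  refine tendsto_tsum_of_dominated_convergence (summable_exp_neg_pi_mul one_pos) (fun n => ?_) ?_
  · split_ifs with h
    · simp [h]
    · have hn : 0 < (n : ℝ) ^ 2 := by positivity
      have h1 : Tendsto (fun s : ℝ => s * (-π * n ^ 2)) atTop atBot :=
        tendsto_id.atTop_mul_const_of_neg (by nlinarith [pi_pos])
      have h2 := (tendsto_exp_atBot.comp h1).const_mul (ε ^ n)
      rw [mul_zero] at h2
      refine h2.congr fun s => ?_
      simp only [Function.comp_apply]
      ring_nf
  · filter_upwards [eventually_ge_atTop 1] with s hs n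
    rw [norm_mul, norm_eq_abs, abs_zpow_eq_one hε, one_mul, norm_of_nonneg (exp_pos _).le,
      exp_le_exp]
    have := mul_le_mul_of_nonneg_left hs (mul_nonneg pi_pos.le (sq_nonneg (n : ℝ)))
    linarith

lemma realTheta_one_pos {s : ℝ} (hs : 0 < s) : 0 < realTheta 1 s := by
  refine (summable_norm_realTheta abs_one hs).of_norm.tsum_pos (fun n => ?_) 0 ?_
  · simp [exp_nonneg]
  · simp

lemma realTheta_one_inv {s : ℝ} (hs : 0 < s) :
    realTheta 1 s⁻¹ = √s * realTheta 1 s := by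
  have h := Real.tsum_exp_neg_mul_int_sq (inv_pos.2 hs)
  rw [← sqrt_eq_rpow, sqrt_inv, one_div, inv_inv] at h
  simp only [div_inv_eq_mul] at h
  simpa [realTheta] using h

lemma tsum_prod_eq_tsum_of_add_even {f : ℤ × ℤ → ℝ}
    (hf : ∀ m n, Odd (m + n) → f (m, n) = 0) :
    ∑' p, f p = ∑' p : ℤ × ℤ, f (p.1 + p.2, p.1 - p.2) := by
  refine (Function.Injective.tsum_eq (g := fun p : ℤ × ℤ => (p.1 + p.2, p.1 - p.2)) ?_ ?_).symm
  · rintro ⟨a, b⟩ ⟨c, d⟩ h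
    simp only [Prod.mk.injEq] at h ⊢
    omega
  · rintro ⟨m, n⟩ h
    rcases Int.even_or_odd' (m + n) with ⟨c, hc | hc⟩
    · exact ⟨(c, m - c), by simp only [Prod.mk.injEq]; omega⟩
    · exact absurd (hf m n ⟨c, hc⟩) h

lemma realTheta_mul {ε δ s : ℝ} (hε : |ε| = 1) (hδ : |δ| = 1) (hs : 0 < s) :
    HasSum (fun p : ℤ × ℤ => ε ^ p.1 * δ ^ p.2 * exp (-π * s * (p.1 ^ 2 + p.2 ^ 2)))
      (realTheta ε s * realTheta δ s) := by
  have h1 := summable_norm_realTheta hε hs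
  have h2 := summable_norm_realTheta hδ hs
  have h := (summable_mul_of_summable_norm h1 h2).hasSum
  rw [← tsum_mul_tsum_of_summable_norm h1 h2] at h
  have hfun : (fun p : ℤ × ℤ => ε ^ p.1 * δ ^ p.2 * exp (-π * s * (p.1 ^ 2 + p.2 ^ 2))) =
      fun p => ε ^ p.1 * exp (-π * s * p.1 ^ 2) * (δ ^ p.2 * exp (-π * s * p.2 ^ 2)) := by
    ext p
    rw [mul_add, exp_add]
    ring
  rw [hfun]
  exact h

lemma exp_sq_add_sq (s : ℝ) (u v : ℤ) :
    exp (-π * s * (((u + v : ℤ) : ℝ) ^ 2 + ((u - v : ℤ) : ℝ) ^ 2)) =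
      exp (-π * (2 * s) * (u ^ 2 + v ^ 2)) := by
  congr 1
  push_cast
  ring

lemma realTheta_sq_add_sq {s : ℝ} (hs : 0 < s) :
    realTheta 1 s ^ 2 + realTheta (-1) s ^ 2 = 2 * realTheta 1 (2 * s) ^ 2 := by
  have h1 : |(1 : ℝ)| = 1 := abs_one
  have h2 : |(-1 : ℝ)| = 1 := by simp
  have h := (realTheta_mul h1 h1 hs).add (realTheta_mul h2 h2 hs)
  have h' := (realTheta_mul h1 h1 (s := 2 * s) (by positivity)).mul_left 2
  rw [pow_two, pow_two, pow_two, ← h.tsum_eq, ← h'.tsum_eq, tsum_prod_eq_tsum_of_add_even]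
  · congr 1 with p
    rw [exp_sq_add_sq, ← zpow_add₀ (by norm_num : (-1 : ℝ) ≠ 0),
      Even.neg_one_zpow ⟨p.1, by ring⟩]
    simp only [one_zpow]
    ring
  · intro m n hmn
    simp only
    rw [← zpow_add₀ (by norm_num : (-1 : ℝ) ≠ 0), hmn.neg_one_zpow]
    simp

lemma realTheta_mul_realTheta {s : ℝ} (hs : 0 < s) :
    realTheta 1 s * realTheta (-1) s = realTheta (-1) (2 * s) ^ 2 := by
  have h1 : |(1 : ℝ)| = 1 := abs_one
  have h2 : |(-1 : ℝ)| = 1 := by simp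
  have h0 : (-1 : ℝ) ≠ 0 := by norm_num
  have h := (realTheta_mul h1 h2 hs).add (realTheta_mul h2 h1 hs)
  have h' := (realTheta_mul h2 h2 (s := 2 * s) (by positivity)).mul_left 2
  have key : realTheta 1 s * realTheta (-1) s + realTheta (-1) s * realTheta 1 s =
      2 * (realTheta (-1) (2 * s) * realTheta (-1) (2 * s)) := by
    rw [← h.tsum_eq, ← h'.tsum_eq, tsum_prod_eq_tsum_of_add_even]
    · congr 1 with p
      have : (-1 : ℝ) ^ (p.1 - p.2) = (-1) ^ (p.1 + p.2) := by
        rw [show p.1 + p.2 = p.1 - p.2 + (p.2 + p.2) by ring, zpow_add₀ h0,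
          Even.neg_one_zpow ⟨p.2, rfl⟩, mul_one]
      rw [exp_sq_add_sq, this, zpow_add₀ h0]
      simp only [one_zpow]
      ring
    · intro m n hmn
      simp only [one_zpow, one_mul, mul_one]
      replace hmn := Int.odd_add.1 hmn
      rcases Int.even_or_odd n with hn | hn
      · rw [hn.neg_one_zpow, (hmn.2 hn).neg_one_zpow]; ring
      · rw [hn.neg_one_zpow, Even.neg_one_zpow (by
          rw [← Int.not_odd_iff_even, hmn, Int.not_even_iff_odd]; exact hn)]; ring
  linarith

lemma tendsto_two_pow_mul {s : ℝ} (hs : 0 < s) : Tendsto (fun n : ℕ => 2 ^ n * s) atTop atTop :=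
  (tendsto_pow_atTop_atTop_of_one_lt one_lt_two).atTop_mul_const hs

lemma realTheta_neg_one_pos {s : ℝ} (hs : 0 < s) : 0 < realTheta (-1) s := by
  have hnn : 0 ≤ realTheta (-1) s := by
    have h := realTheta_mul_realTheta hs
    exact nonneg_of_mul_nonneg_right (h ▸ sq_nonneg _) (realTheta_one_pos hs)
  refine hnn.lt_of_ne' fun h0 => ?_
  have hz : ∀ n : ℕ, realTheta (-1) (2 ^ n * s) = 0 := by
    intro n
    induction n with
    | zero => simpa using h0
    | succ n ih =>
      have h := realTheta_mul_realTheta (s := 2 ^ n * s) (by positivity)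
      rw [ih, mul_zero, ← mul_assoc, ← pow_succ'] at h
      exact pow_eq_zero_iff two_ne_zero |>.1 h.symm
  have hlim := (tendsto_realTheta_atTop (ε := -1) (by simp)).comp (tendsto_two_pow_mul hs)
  exact zero_ne_one (tendsto_nhds_unique (tendsto_const_nhds.congr fun n => (hz n).symm) hlim)

/-- Jacobi's quartic identity, with `θ₂` expressed through the modular inversion of `θ₄`. -/
lemma realTheta_quartic {s : ℝ} (hs : 0 < s) :
    realTheta 1 s ^ 4 - realTheta (-1) s ^ 4 = s⁻¹ ^ 2 * realTheta (-1) s⁻¹ ^ 4 := by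
  obtain ⟨r, rfl⟩ : ∃ r, s = 2 * r := ⟨s / 2, by ring⟩
  have hr : 0 < r := by linarith
  have e1 := realTheta_sq_add_sq hr
  have e2 := realTheta_mul_realTheta hr
  have e3 := realTheta_sq_add_sq (inv_pos.2 hs)
  have e4 : 2 * (2 * r)⁻¹ = r⁻¹ := by field_simp
  rw [e4, realTheta_one_inv hs, realTheta_one_inv hr, mul_pow, mul_pow, sq_sqrt hs.le,
    sq_sqrt hr.le] at e3
  have e5 : realTheta (-1) (2 * r)⁻¹ ^ 2 =
      r * (realTheta 1 r ^ 2 - realTheta (-1) r ^ 2) := by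
    linear_combination e3 + r * e1
  have e6 : realTheta (-1) (2 * r)⁻¹ ^ 4 =
      (r * (realTheta 1 r ^ 2 - realTheta (-1) r ^ 2)) ^ 2 := by rw [← e5]; ring
  have e7 : realTheta 1 (2 * r) ^ 4 = ((realTheta 1 r ^ 2 + realTheta (-1) r ^ 2) / 2) ^ 2 := by
    rw [e1]; ring
  have e8 : realTheta (-1) (2 * r) ^ 4 = (realTheta 1 r * realTheta (-1) r) ^ 2 := by
    rw [e2]; ring
  rw [e6, e7, e8]
  field_simp
  ring

lemma gaussIntegral_realTheta {s : ℝ} (hs : 0 < s) :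
    gaussIntegral (realTheta 1 s ^ 2) (realTheta (-1) s ^ 2) = π / 2 := by
  have hstep : ∀ n : ℕ, gaussIntegral (realTheta 1 (2 ^ n * s) ^ 2)
      (realTheta (-1) (2 ^ n * s) ^ 2) =
      gaussIntegral (realTheta 1 s ^ 2) (realTheta (-1) s ^ 2) := by
    intro n
    induction n with
    | zero => simp
    | succ n ih =>
      have hp : 0 < 2 ^ n * s := by positivity
      have h3 := realTheta_one_pos hp
      have h4 := realTheta_neg_one_pos hp
      rw [← ih, ← gaussIntegral_agm (pow_pos h3 2) (pow_pos h4 2), realTheta_sq_add_sq hp,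
        ← mul_pow, sqrt_sq (by positivity), realTheta_mul_realTheta hp, ← mul_assoc, ← pow_succ',
        mul_div_cancel_left₀ _ two_ne_zero]
  have h3 := (tendsto_realTheta_atTop (ε := 1) (by simp)).comp (tendsto_two_pow_mul hs)
  have h4 := (tendsto_realTheta_atTop (ε := -1) (by simp)).comp (tendsto_two_pow_mul hs)
  have hK : Tendsto legendreK (𝓝 (1 - (1 ^ 2 / 1 ^ 2) ^ 2)) (𝓝 (π / 2)) := by
    rw [← legendreK_zero]
    simpa using (hasDerivAt_legendreK' one_pos).continuousAt.tendsto
  have hlim := ((h3.pow 2).inv₀ (by simp)).mul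
    (hK.comp ((((h4.pow 2).div (h3.pow 2) (by simp)).pow 2).const_sub 1))
  rw [one_pow, inv_one, one_mul] at hlim
  refine tendsto_nhds_unique (tendsto_const_nhds.congr fun n => ?_) hlim
  rw [← hstep n, gaussIntegral_eq_legendreK (pow_pos (realTheta_one_pos (by positivity)) 2)]
  rfl

lemma legendreK_realTheta {s : ℝ} (hs : 0 < s) :
    legendreK (1 - (realTheta (-1) s ^ 2 / realTheta 1 s ^ 2) ^ 2) =
      π / 2 * realTheta 1 s ^ 2 := by
  have h3 := realTheta_one_pos hs
  have h := gaussIntegral_realTheta hs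
  rw [gaussIntegral_eq_legendreK (by positivity)] at h
  rw [← h]
  field_simp

lemma realTheta_modulus_inv {s : ℝ} (hs : 0 < s) :
    (realTheta (-1) s⁻¹ ^ 2 / realTheta 1 s⁻¹ ^ 2) ^ 2 =
      1 - (realTheta (-1) s ^ 2 / realTheta 1 s ^ 2) ^ 2 := by
  have h3 := realTheta_one_pos hs
  have h := realTheta_quartic hs
  have e : (√s * realTheta 1 s) ^ 4 = s ^ 2 * realTheta 1 s ^ 4 := by
    rw [mul_pow, show √s ^ 4 = (√s ^ 2) ^ 2 by ring, sq_sqrt hs.le]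
  rw [realTheta_one_inv hs, div_pow, div_pow, ← pow_mul, ← pow_mul, ← pow_mul, ← pow_mul, e]
  generalize realTheta (-1) s⁻¹ = t at h ⊢
  field_simp at h ⊢
  rw [← h]
  ring

lemma exists_realTheta_modulus {m : ℝ} (hm : m ∈ Ioo 0 1) :
    ∃ s, 0 < s ∧ (realTheta (-1) s ^ 2 / realTheta 1 s ^ 2) ^ 2 = 1 - m := by
  have hcont : ContinuousOn (fun s => (realTheta (-1) s ^ 2 / realTheta 1 s ^ 2) ^ 2) (Ioi 0) := by
    intro s hs
    have c3 := (hasDerivAt_realTheta abs_one (mem_Ioi.1 hs)).continuousAt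
    have c4 := (hasDerivAt_realTheta (ε := -1) (by simp) (mem_Ioi.1 hs)).continuousAt
    exact (((c4.pow 2).div (c3.pow 2)
      (pow_ne_zero 2 (realTheta_one_pos hs).ne')).pow 2).continuousWithinAt
  have htop : Tendsto (fun s => (realTheta (-1) s ^ 2 / realTheta 1 s ^ 2) ^ 2) atTop (𝓝 1) := by
    simpa using ((((tendsto_realTheta_atTop (ε := -1) (by simp)).pow 2).div
      ((tendsto_realTheta_atTop (ε := 1) (by simp)).pow 2) (by simp)).pow 2)
  have hzero : Tendsto (fun s => (realTheta (-1) s ^ 2 / realTheta 1 s ^ 2) ^ 2) (𝓝[>] 0)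
      (𝓝 0) := by
    have h := (htop.comp tendsto_inv_nhdsGT_zero).const_sub 1
    rw [sub_self] at h
    refine h.congr' ?_
    filter_upwards [self_mem_nhdsWithin] with s hs
    simp only [Function.comp_apply]
    rw [realTheta_modulus_inv hs]
    ring
  obtain ⟨s, hs, h⟩ := isPreconnected_Ioi.intermediate_value_Ioo
    (l₁ := 𝓝[>] (0:ℝ)) (l₂ := atTop) inf_le_right (le_principal_iff.2 (Ioi_mem_atTop 0)) hcont
    hzero htop (show 1 - m ∈ Ioo 0 1 from ⟨by linarith [hm.2], by linarith [hm.1]⟩)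
  exact ⟨s, hs, h⟩

/-- Jacobi's formula `θ₃² = 2 K / π`, as a function of the parameter `m`. -/
lemma realTheta_sq_eq_legendreK {m : ℝ} (hm : m ∈ Ioo 0 1) :
    realTheta 1 (legendreK (1 - m) / legendreK m) ^ 2 = 2 / π * legendreK m := by
  obtain ⟨s, hs, h⟩ := exists_realTheta_modulus hm
  have hK := legendreK_realTheta hs
  have hK' := legendreK_realTheta (inv_pos.2 hs)
  rw [realTheta_modulus_inv hs, h, realTheta_one_inv hs, mul_pow, sq_sqrt hs.le] at hK'
  rw [h, sub_sub_cancel] at hK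
  rw [sub_sub_cancel] at hK'
  have h3 := realTheta_one_pos hs
  have : legendreK (1 - m) / legendreK m = s := by
    rw [hK, hK']
    field_simp
  rw [this, hK]
  field_simp

/-- The logarithmic derivative of `θ₃` in terms of complete elliptic integrals. -/
lemma tsum_sq_mul_exp_div_realTheta {m : ℝ} (hm : m ∈ Ioo 0 1) :
    (∑' n : ℤ, (n : ℝ) ^ 2 * exp (-π * (legendreK (1 - m) / legendreK m) * n ^ 2)) /
      realTheta 1 (legendreK (1 - m) / legendreK m) =
    legendreK m ^ 2 / π ^ 2 * (legendreE m / legendreK m - (1 - m)) := by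
  obtain ⟨h0, h1⟩ := hm
  have h0' : 1 - m ≠ 0 := by linarith
  have hKpos := legendreK_pos h1
  have hKpos' : 0 < legendreK (1 - m) := legendreK_pos (by linarith)
  have hs : 0 < legendreK (1 - m) / legendreK m := by positivity
  have hsub : HasDerivAt (fun x : ℝ => 1 - x) (-1) m := by
    simpa using (hasDerivAt_id m).const_sub 1
  have K := hasDerivAt_legendreK h0.ne' h1
  have K' := (hasDerivAt_legendreK h0' (by linarith)).comp m hsub
  have hS := K'.div K hKpos.ne'
  have hθ := ((hasDerivAt_realTheta abs_one hs).comp m hS).pow 2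
  have heq : (fun x => realTheta 1 (legendreK (1 - x) / legendreK x) ^ 2) =ᶠ[𝓝 m]
      fun x => 2 / π * legendreK x := by
    filter_upwards [Ioo_mem_nhds h0 h1] with x hx using realTheta_sq_eq_legendreK hx
  have huniq := hθ.unique ((K.const_mul (2 / π)).congr_of_eventuallyEq heq)
  have hleg := legendre_relation ⟨h0, h1⟩
  have hsq := realTheta_sq_eq_legendreK ⟨h0, h1⟩
  have h3 := realTheta_one_pos hs
  have htsum : ∑' n : ℤ, (1 : ℝ) ^ n *
      (exp (-π * (legendreK (1 - m) / legendreK m) * n ^ 2) * (-π * n ^ 2)) =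
      -π * ∑' n : ℤ, (n : ℝ) ^ 2 * exp (-π * (legendreK (1 - m) / legendreK m) * n ^ 2) := by
    rw [← tsum_mul_left]
    congr 1 with n
    rw [one_zpow]
    ring
  simp only [Function.comp_apply, Pi.div_apply, sub_sub_cancel] at huniq
  rw [htsum] at huniq
  generalize (∑' n : ℤ, (n : ℝ) ^ 2 * exp (-π * (legendreK (1 - m) / legendreK m) * n ^ 2)) = V
    at huniq ⊢
  generalize realTheta 1 (legendreK (1 - m) / legendreK m) = T at huniq hsq h3 ⊢
  generalize legendreK (1 - m) = K₁ at *
  generalize legendreE (1 - m) = E₁ at *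
  generalize legendreK m = K₀ at *
  generalize legendreE m = E₀ at *
  have hS' : ((E₁ - m * K₁) / (2 * (1 - m) * m) * -1 * K₀ -
      K₁ * ((E₀ - (1 - m) * K₀) / (2 * m * (1 - m)))) / K₀ ^ 2 =
      -(π / 2) / (2 * m * (1 - m) * K₀ ^ 2) := by
    rw [← hleg]
    field_simp
    ring
  rw [hS'] at huniq
  have hV : T * V * π ^ 3 = 2 * K₀ ^ 2 * (E₀ - (1 - m) * K₀) := by
    field_simp at huniq
    push_cast at huniq
    linear_combination huniq / 2
  rw [div_eq_iff h3.ne', ← mul_left_inj' h3.ne', mul_assoc _ T T, ← pow_two, hsq]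
  field_simp
  linear_combination hV

end

/-- Variance of the discrete normal distribution with nome `q = exp(-π K'(k)/K(k))`. -/
theorem theta3_variance (k : ℝ) (hk0 : 0 < k) (hk1 : k < 1)
    (q : ℝ) (hq : q = Real.exp (-(π * ellipticK (Real.sqrt (1 - k ^ 2)) / ellipticK k))) :
    (∑' p : ℤ, (p : ℝ) ^ 2 * q ^ (p.natAbs ^ 2)) / (∑' p : ℤ, q ^ (p.natAbs ^ 2)) =
      ellipticK k ^ 2 / π ^ 2 *
        (ellipticE k / ellipticK k - Real.sqrt (1 - k ^ 2) ^ 2) := by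
  have hk : k ^ 2 ∈ Set.Ioo (0:ℝ) 1 := ⟨by positivity, by nlinarith⟩
  have hk' : 0 ≤ 1 - k ^ 2 := by linarith [hk.2]
  have h := tsum_sq_mul_exp_div_realTheta hk
  rw [ellipticK_eq_legendreK, ellipticK_eq_legendreK, Real.sq_sqrt hk'] at hq
  rw [ellipticK_eq_legendreK, ellipticE_eq_legendreE, Real.sq_sqrt hk', ← h, realTheta]
  have hpow : ∀ p : ℤ, q ^ (p.natAbs ^ 2) =
      Real.exp (-π * (legendreK (1 - k ^ 2) / legendreK (k ^ 2)) * p ^ 2) := by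
    intro p
    rw [hq, ← Real.exp_nat_mul]
    congr 1
    push_cast
    rw [Nat.cast_natAbs, Int.cast_abs, sq_abs]
    ring
  simp only [hpow, one_zpow, one_mul]
end

section
/- For the discrete normal distribution with q = e^{-π}, the fourth cumulant equals κ₄ = Γ(1/4)⁸/(2⁹ π⁶); explicitly, μ₄ − 3μ₂² = Γ(1/4)⁸/(2⁹ π⁶), where μ_j = (1/θ₃(e^{-π})) ∑_{p∈ℤ} p^j e^{-π p²}. -/
open Real

open Filter Topology Set

/-- The theta moment `∑ n ^ k * exp (-π n² t)`. -/
noncomputable def thetaMoment (k : ℕ) (t : ℝ) : ℝ :=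
  ∑' n : ℤ, (n : ℝ) ^ k * exp (-π * (n : ℝ) ^ 2 * t)

lemma summable_abs_pow_mul_exp (k : ℕ) {t : ℝ} (ht : 0 < t) :
    Summable fun n : ℤ ↦ |(n : ℝ)| ^ k * exp (-π * (n : ℝ) ^ 2 * t) := by
  refine (summable_pow_mul_jacobiTheta₂_term_bound 0 ht k).congr fun n ↦ ?_
  push_cast
  ring_nf

lemma summable_thetaMoment (k : ℕ) {t : ℝ} (ht : 0 < t) :
    Summable fun n : ℤ ↦ (n : ℝ) ^ k * exp (-π * (n : ℝ) ^ 2 * t) :=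
  (summable_abs_pow_mul_exp k ht).of_norm_bounded fun n ↦ by simp

lemma hasDerivAt_thetaMoment (k : ℕ) {t : ℝ} (ht : 0 < t) :
    HasDerivAt (thetaMoment k) (-π * thetaMoment (k + 2) t) t := by
  have key := hasDerivAt_tsum_of_isPreconnected (t := Ioi (t / 2)) (y := t) (y₀ := t)
    (g := fun (n : ℤ) y ↦ (n : ℝ) ^ k * exp (-π * (n : ℝ) ^ 2 * y))
    (g' := fun (n : ℤ) y ↦ -π * ((n : ℝ) ^ (k + 2) * exp (-π * (n : ℝ) ^ 2 * y)))
    ((summable_abs_pow_mul_exp (k + 2) (half_pos ht)).mul_left π) isOpen_Ioi isPreconnected_Ioi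
    (fun n y _ ↦ ?_) (fun n y hy ↦ ?_) (by simp [ht]) (summable_thetaMoment k ht) (by simp [ht])
  · rwa [tsum_mul_left] at key
  · exact (((hasDerivAt_id' y).const_mul (-π * (n : ℝ) ^ 2)).exp.const_mul
      ((n : ℝ) ^ k)).congr_deriv (by ring)
  · simp only [norm_mul, norm_neg, norm_pow, norm_eq_abs, abs_of_pos pi_pos, abs_exp]
    gcongr π * (_ * exp ?_)
    have := (mem_Ioi.mp hy).le
    nlinarith [mul_nonneg (mul_nonneg pi_pos.le (sq_nonneg (n : ℝ))) (sub_nonneg.mpr this)]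

lemma tendsto_exp_mul_thetaMoment {k : ℕ} (hk : Even k) :
    Tendsto (fun t ↦ exp (π * t) * (thetaMoment k t - if k = 0 then 1 else 0)) atTop (𝓝 2) := by
  set f : ℝ → ℤ → ℝ := fun t n ↦
    if n = 0 then 0 else (n : ℝ) ^ k * exp (-π * ((n : ℝ) ^ 2 - 1) * t) with hf
  have h_lim : Tendsto (fun t ↦ ∑' n, f t n) atTop
      (𝓝 (∑' n : ℤ, if n ∈ ({1, -1} : Finset ℤ) then 1 else 0)) := by
    refine tendsto_tsum_of_dominated_convergence
      (bound := fun n : ℤ ↦ exp π * (|(n : ℝ)| ^ k * exp (-π * (n : ℝ) ^ 2 * 1)))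
      ((summable_abs_pow_mul_exp k one_pos).mul_left _) (fun n ↦ ?_) ?_
    · by_cases h0 : n = 0
      · simp [hf, h0]
      by_cases h1 : n = 1 ∨ n = -1
      · rcases h1 with rfl | rfl <;> simp [hf, hk.neg_pow]
      · have h2 : (1 : ℝ) < (n : ℝ) ^ 2 := by
          have : 1 < n ^ 2 := by
            have : 2 ≤ |n| := by rw [le_abs]; omega
            nlinarith [sq_abs n]
          exact_mod_cast this
        simp only [hf, h0, if_false, Finset.mem_insert, Finset.mem_singleton, h1]
        have : Tendsto (fun t ↦ -π * ((n : ℝ) ^ 2 - 1) * t) atTop atBot :=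
          tendsto_id.const_mul_atTop_of_neg (by nlinarith [pi_pos])
        simpa using (tendsto_exp_atBot.comp this).const_mul ((n : ℝ) ^ k)
    · filter_upwards [eventually_ge_atTop 1] with t ht n
      by_cases h0 : n = 0
      · simp only [hf, h0, if_true, norm_zero]
        positivity
      · have h2 : (1 : ℝ) ≤ (n : ℝ) ^ 2 := by
          have : 1 ≤ n ^ 2 := by have := sq_pos_of_ne_zero h0; omega
          exact_mod_cast this
        simp only [hf, h0, if_false, norm_mul, norm_pow, norm_eq_abs, abs_exp]
        rw [mul_left_comm, ← exp_add]
        gcongr _ * exp ?_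
        nlinarith [mul_nonneg (mul_nonneg pi_pos.le (sub_nonneg.mpr h2)) (sub_nonneg.mpr ht)]
  rw [tsum_eq_sum (s := {1, -1}) (fun n hn ↦ by simp [hn])] at h_lim
  norm_num [Finset.sum_ite_mem] at h_lim
  refine h_lim.congr' ?_
  filter_upwards [eventually_gt_atTop 0] with t ht
  have h := (hasSum_ite_sub_hasSum (summable_thetaMoment k ht).hasSum 0).mul_left (exp (π * t))
  have h' : exp (π * t) * (thetaMoment k t - if k = 0 then 1 else 0) =
      exp (π * t) * (∑' n : ℤ, (n : ℝ) ^ k * exp (-π * (n : ℝ) ^ 2 * t) -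
        ((0 : ℤ) : ℝ) ^ k * exp (-π * ((0 : ℤ) : ℝ) ^ 2 * t)) := by
    rcases eq_or_ne k 0 with rfl | hk0
    · simp [thetaMoment]
    · simp [thetaMoment, hk0]
  rw [h', ← h.tsum_eq]
  refine tsum_congr fun n ↦ ?_
  simp only [hf, mul_ite, mul_zero]
  split_ifs
  · rfl
  · rw [mul_left_comm, ← exp_add]
    ring_nf

lemma HasSum.int_even_add_odd {f : ℤ → ℝ} {a b : ℝ} (he : HasSum (fun n ↦ f (2 * n)) a)
    (ho : HasSum (fun n ↦ f (2 * n + 1)) b) : HasSum f (a + b) := by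
  have hinj := mul_right_injective₀ (two_ne_zero' ℤ)
  replace he := hinj.hasSum_range_iff.2 he
  replace ho := ((add_left_injective 1).comp hinj).hasSum_range_iff.2 ho
  refine he.add_isCompl ?_ ho
  simpa [Function.comp_def] using Int.isCompl_even_odd

lemma hasSum_theta {t : ℝ} (ht : 0 < t) :
    HasSum (fun n : ℤ ↦ exp (-π * (n : ℝ) ^ 2 * t)) (thetaMoment 0 t) := by
  simpa [thetaMoment] using (summable_thetaMoment 0 ht).hasSum

lemma hasSum_theta_add_half {t : ℝ} (ht : 0 < t) :
    HasSum (fun n : ℤ ↦ exp (-π * ((n : ℝ) + 1 / 2) ^ 2 * t))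
      (thetaMoment 0 (t / 4) - thetaMoment 0 t) := by
  have hs := (HurwitzZeta.hasSum_int_evenKernel (1 / 2) ht).summable.hasSum
  suffices thetaMoment 0 (t / 4) = thetaMoment 0 t +
      ∑' n : ℤ, exp (-π * ((n : ℝ) + 1 / 2) ^ 2 * t) by
    rwa [this, add_sub_cancel_left]
  refine (hasSum_theta (by positivity)).unique (HasSum.int_even_add_odd ?_ ?_)
  · convert hasSum_theta ht using 3
    push_cast
    ring
  · convert hs using 3
    push_cast
    ring

lemma theta_one_div {t : ℝ} (ht : 0 < t) : thetaMoment 0 (1 / t) = √t * thetaMoment 0 t := by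
  have := Real.tsum_exp_neg_mul_int_sq ht
  simp only [thetaMoment, pow_zero, one_mul]
  simp only [← sqrt_eq_rpow] at this
  have h1 : ∑' n : ℤ, exp (-π * (n : ℝ) ^ 2 * t) = ∑' n : ℤ, exp (-π * t * (n : ℝ) ^ 2) := by
    congr! 3; ring
  have h2 : ∑' n : ℤ, exp (-π * (n : ℝ) ^ 2 * (1 / t)) = ∑' n : ℤ, exp (-π / t * (n : ℝ) ^ 2) := by
    congr! 3; ring
  rw [h1, h2, this]
  field_simp

lemma theta_sq {t : ℝ} (ht : 0 < t) :
    thetaMoment 0 t ^ 2 = thetaMoment 0 (2 * t) ^ 2 +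
      (thetaMoment 0 (t / 2) - thetaMoment 0 (2 * t)) ^ 2 := by
  have h2t : 0 < 2 * t := by positivity
  have hθ := hasSum_theta h2t
  have hθ' := hasSum_theta_add_half h2t
  rw [show 2 * t / 4 = t / 2 by ring] at hθ'
  have hprod := (hasSum_theta ht).mul (hasSum_theta ht) ((hasSum_theta ht).summable.mul_of_nonneg
    (hasSum_theta ht).summable (fun _ ↦ (exp_pos _).le) fun _ ↦ (exp_pos _).le)
  let e : ℤ × ℤ ≃ ℤ × ℤ :=
    { toFun := fun p ↦ (p.2, p.2 + p.1)
      invFun := fun p ↦ (p.2 - p.1, p.1)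
      left_inv := fun p ↦ by simp
      right_inv := fun p ↦ by simp }
  rw [← e.hasSum_iff] at hprod
  have hfib (c : ℤ) := hprod.summable.prod_factor c
  have hsum := hprod.prod_fiberwise fun c ↦ (hfib c).hasSum
  rw [sq, sq, sq]
  refine hsum.unique (HasSum.int_even_add_odd ?_ ?_)
  · refine (hθ.mul_right _).congr_fun fun m ↦ ?_
    rw [← (((Equiv.addRight m).hasSum_iff.mpr hθ).mul_left _).tsum_eq]
    refine tsum_congr fun a ↦ ?_
    simp only [e, Function.comp_apply, Equiv.coe_fn_mk, Equiv.coe_addRight, ← exp_add]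
    push_cast
    ring_nf
  · refine (hθ'.mul_right _).congr_fun fun m ↦ ?_
    rw [← (((Equiv.addRight m).hasSum_iff.mpr hθ').mul_left _).tsum_eq]
    refine tsum_congr fun a ↦ ?_
    simp only [e, Function.comp_apply, Equiv.coe_fn_mk, Equiv.coe_addRight, ← exp_add]
    push_cast
    ring_nf

/-- The theta constant `θ₃` at `q = exp (-π t)`. -/
noncomputable def theta₃ (t : ℝ) : ℝ := thetaMoment 0 t

/-- The theta constant `θ₂` at `q = exp (-π t)`. -/
noncomputable def theta₂ (t : ℝ) : ℝ := theta₃ (t / 4) - theta₃ t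

/-- The theta constant `θ₄` at `q = exp (-π t)`. -/
noncomputable def theta₄ (t : ℝ) : ℝ := 2 * theta₃ (4 * t) - theta₃ t

section identities

variable {t : ℝ}

lemma theta₃_pos (ht : 0 < t) : 0 < theta₃ t := by
  rw [theta₃, ← (hasSum_theta ht).tsum_eq]
  exact (hasSum_theta ht).summable.tsum_pos (fun _ ↦ (exp_pos _).le) 0 (exp_pos _)

lemma theta₂_pos (ht : 0 < t) : 0 < theta₂ t := by
  rw [theta₂, theta₃, theta₃, ← (hasSum_theta_add_half ht).tsum_eq]
  exact (hasSum_theta_add_half ht).summable.tsum_pos (fun _ ↦ (exp_pos _).le) 0 (exp_pos _)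

lemma theta₃_one_div (ht : 0 < t) : theta₃ (1 / t) = √t * theta₃ t := theta_one_div ht

lemma theta₂_one_div (ht : 0 < t) : theta₂ (1 / t) = √t * theta₄ t := by
  have h4 : √(4 * t) = 2 * √t := by
    rw [sqrt_mul (by norm_num), show (4 : ℝ) = 2 ^ 2 by norm_num, sqrt_sq (by norm_num)]
  rw [theta₂, theta₄, show 1 / t / 4 = 1 / (4 * t) by field_simp, theta₃_one_div ht,
    theta₃_one_div (by positivity), h4]
  ring

lemma theta₄_one_div (ht : 0 < t) : theta₄ (1 / t) = √t * theta₂ t := by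
  have h := theta₂_one_div (one_div_pos.mpr ht)
  rw [one_div_one_div] at h
  rw [h, ← mul_assoc, ← sqrt_mul ht.le, mul_one_div_cancel ht.ne', sqrt_one, one_mul]

lemma theta₄_pos (ht : 0 < t) : 0 < theta₄ t := by
  have h := theta₂_pos (one_div_pos.mpr ht)
  rw [theta₂_one_div ht] at h
  exact pos_of_mul_pos_right h (sqrt_nonneg t)

lemma theta₃_sq_add_theta₄_sq (ht : 0 < t) :
    theta₃ t ^ 2 + theta₄ t ^ 2 = 2 * theta₃ (2 * t) ^ 2 := by
  have h := theta_sq (t := 2 * t) (by positivity)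
  rw [show 2 * (2 * t) = 4 * t by ring, show 2 * t / 2 = t by ring] at h
  simp only [theta₄, theta₃]
  linear_combination -2 * h

lemma theta₂_two_mul_sq (ht : 0 < t) :
    theta₂ (2 * t) ^ 2 = theta₃ t ^ 2 - theta₃ (2 * t) ^ 2 := by
  have h := theta_sq ht
  rw [theta₂, show 2 * t / 4 = t / 2 by ring]
  simp only [theta₃]
  linear_combination -h

lemma theta₂_sq (ht : 0 < t) : theta₂ t ^ 2 = 2 * theta₂ (2 * t) * theta₃ (2 * t) := by
  have h := theta_sq (t := t / 2) (by positivity)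
  have h' := theta_sq ht
  rw [theta₂, theta₂, show 2 * t / 4 = t / 2 by ring]
  rw [show 2 * (t / 2) = t by ring, show t / 2 / 2 = t / 4 by ring] at h
  simp only [theta₃]
  linear_combination -h - h'

lemma theta₄_two_mul_sq (ht : 0 < t) : theta₄ (2 * t) ^ 2 = theta₃ t * theta₄ t := by
  have h2t : 0 < 2 * t := by positivity
  have h := theta₂_sq (one_div_pos.mpr h2t)
  rw [show 2 * (1 / (2 * t)) = 1 / t by field_simp, theta₂_one_div h2t, theta₂_one_div ht,
    theta₃_one_div ht, mul_pow, sq_sqrt h2t.le] at h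
  refine mul_left_cancel₀ h2t.ne' ?_
  linear_combination h + 2 * theta₄ t * theta₃ t * sq_sqrt ht.le

lemma theta₃_pow_four (ht : 0 < t) : theta₃ t ^ 4 = theta₂ t ^ 4 + theta₄ t ^ 4 := by
  have h2 : 0 < t / 2 := by positivity
  have h₁ := theta₃_sq_add_theta₄_sq h2
  have h₂ := theta₂_two_mul_sq h2
  have h₃ := theta₄_two_mul_sq h2
  rw [show 2 * (t / 2) = t by ring] at h₁ h₂ h₃
  have h₄ : theta₃ (t / 2) ^ 2 = theta₃ t ^ 2 + theta₂ t ^ 2 := by linarith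
  have h₅ : theta₄ (t / 2) ^ 2 = theta₃ t ^ 2 - theta₂ t ^ 2 := by linarith
  have h₆ : theta₄ t ^ 4 = theta₃ (t / 2) ^ 2 * theta₄ (t / 2) ^ 2 := by
    rw [← mul_pow, ← h₃]; ring
  rw [h₆, h₄, h₅]
  ring

lemma theta₄_lt_theta₃ (ht : 0 < t) : theta₄ t < theta₃ t :=
  lt_of_pow_lt_pow_left₀ 4 (theta₃_pos ht).le (by
    have := pow_pos (theta₂_pos ht) 4
    linarith [theta₃_pow_four ht])

end identities

section derivatives

variable {t : ℝ}

lemma hasDerivAt_theta₃ (ht : 0 < t) : HasDerivAt theta₃ (logDeriv theta₃ t * theta₃ t) t := by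
  rw [logDeriv_apply, div_mul_cancel₀ _ (theta₃_pos ht).ne']
  exact (hasDerivAt_thetaMoment 0 ht).differentiableAt.hasDerivAt

lemma hasDerivAt_theta₃_comp_mul {c : ℝ} (hc : 0 < c) (ht : 0 < t) :
    HasDerivAt (fun s ↦ theta₃ (c * s)) (logDeriv theta₃ (c * t) * theta₃ (c * t) * c) t :=
  (hasDerivAt_theta₃ (mul_pos hc ht)).comp t (by simpa using (hasDerivAt_id t).const_mul c)

lemma hasDerivAt_theta₂ (ht : 0 < t) : HasDerivAt theta₂ (logDeriv theta₂ t * theta₂ t) t := by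
  rw [logDeriv_apply, div_mul_cancel₀ _ (theta₂_pos ht).ne']
  refine DifferentiableAt.hasDerivAt ?_
  have h := (hasDerivAt_theta₃_comp_mul (c := 1 / 4) (by norm_num) ht).sub (hasDerivAt_theta₃ ht)
  convert h.differentiableAt using 1
  ext s
  rw [theta₂, Pi.sub_apply, one_div_mul_eq_div]

lemma hasDerivAt_theta₄ (ht : 0 < t) : HasDerivAt theta₄ (logDeriv theta₄ t * theta₄ t) t := by
  rw [logDeriv_apply, div_mul_cancel₀ _ (theta₄_pos ht).ne']
  refine DifferentiableAt.hasDerivAt ?_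
  exact (((hasDerivAt_theta₃_comp_mul (c := 4) (by norm_num) ht).const_mul 2).sub
    (hasDerivAt_theta₃ ht)).differentiableAt

lemma HasDerivAt.eq_of_eqOn_Ioi {f g : ℝ → ℝ} {f' g' : ℝ} (ht : 0 < t) (hf : HasDerivAt f f' t)
    (hg : HasDerivAt g g' t) (h : ∀ s, 0 < s → f s = g s) : f' = g' :=
  hf.unique (hg.congr_of_eventuallyEq (eventually_of_mem (Ioi_mem_nhds ht) h))

lemma HasDerivAt.comp_two_mul {f : ℝ → ℝ} {f' : ℝ} (hf : HasDerivAt f f' (2 * t)) :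
    HasDerivAt (fun s ↦ f (2 * s)) (f' * 2) t :=
  hf.comp t (by simpa using (hasDerivAt_id t).const_mul 2)

lemma logDeriv_theta₄_two_mul (ht : 0 < t) :
    4 * logDeriv theta₄ (2 * t) = logDeriv theta₃ t + logDeriv theta₄ t := by
  have h2t : 0 < 2 * t := by positivity
  have h := HasDerivAt.eq_of_eqOn_Ioi ht ((hasDerivAt_theta₄ h2t).comp_two_mul.pow 2)
    ((hasDerivAt_theta₃ ht).mul (hasDerivAt_theta₄ ht)) fun s hs ↦ by
      simpa using theta₄_two_mul_sq hs
  refine mul_right_cancel₀ (mul_pos (theta₃_pos ht) (theta₄_pos ht)).ne' ?_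
  push_cast at h
  linear_combination h - 4 * logDeriv theta₄ (2 * t) * theta₄_two_mul_sq ht

lemma logDeriv_theta₂_two_mul_add (ht : 0 < t) :
    logDeriv theta₂ (2 * t) + logDeriv theta₃ (2 * t) = logDeriv theta₂ t := by
  have h2t : 0 < 2 * t := by positivity
  have h := HasDerivAt.eq_of_eqOn_Ioi ht ((hasDerivAt_theta₂ ht).pow 2)
    (((hasDerivAt_theta₂ h2t).comp_two_mul.const_mul 2).mul (hasDerivAt_theta₃ h2t).comp_two_mul)
    fun s hs ↦ by simpa using theta₂_sq hs
  refine mul_right_cancel₀ (pow_pos (theta₂_pos ht) 2).ne' ?_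
  push_cast at h
  linear_combination -h / 2 +
    (logDeriv theta₂ (2 * t) + logDeriv theta₃ (2 * t)) * theta₂_sq ht

lemma logDeriv_theta₃_two_mul (ht : 0 < t) :
    theta₃ t ^ 2 * logDeriv theta₃ t + theta₄ t ^ 2 * logDeriv theta₄ t =
      4 * theta₃ (2 * t) ^ 2 * logDeriv theta₃ (2 * t) := by
  have h2t : 0 < 2 * t := by positivity
  have h := HasDerivAt.eq_of_eqOn_Ioi ht
    (((hasDerivAt_theta₃ ht).pow 2).add ((hasDerivAt_theta₄ ht).pow 2))
    (((hasDerivAt_theta₃ h2t).comp_two_mul.pow 2).const_mul 2)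
    fun s hs ↦ by simpa using theta₃_sq_add_theta₄_sq hs
  push_cast at h
  linear_combination h / 2

lemma logDeriv_sub_div_theta₂_two_mul (ht : 0 < t) :
    (logDeriv theta₃ (2 * t) - logDeriv theta₄ (2 * t)) / theta₂ (2 * t) ^ 4 =
      (logDeriv theta₃ t - logDeriv theta₄ t) / theta₂ t ^ 4 := by
  have h2t : 0 < 2 * t := by positivity
  have h₁ := logDeriv_theta₃_two_mul ht
  have h₂ := logDeriv_theta₄_two_mul ht
  have h₃ := theta₃_sq_add_theta₄_sq ht
  have h₄ := theta₂_two_mul_sq ht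
  have h₅ : theta₂ t ^ 4 = 4 * theta₂ (2 * t) ^ 2 * theta₃ (2 * t) ^ 2 := by
    rw [show theta₂ t ^ 4 = (theta₂ t ^ 2) ^ 2 by ring, theta₂_sq ht]; ring
  rw [div_eq_div_iff (pow_pos (theta₂_pos h2t) 4).ne' (pow_pos (theta₂_pos ht) 4).ne', h₅]
  have h₆ : 4 * theta₃ (2 * t) ^ 2 * (logDeriv theta₃ (2 * t) - logDeriv theta₄ (2 * t)) =
      theta₂ (2 * t) ^ 2 * (logDeriv theta₃ t - logDeriv theta₄ t) := by
    linear_combination -h₁ - theta₃ (2 * t) ^ 2 * h₂ + logDeriv theta₄ t * h₃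
      - (logDeriv theta₃ t - logDeriv theta₄ t) * h₄
  linear_combination theta₂ (2 * t) ^ 2 * h₆

end derivatives

section asymptotics

lemma tendsto_exp_neg_mul {c : ℝ} (hc : 0 < c) :
    Tendsto (fun t ↦ exp (-(c * t))) atTop (𝓝 0) :=
  tendsto_exp_neg_atTop_nhds_zero.comp (tendsto_id.const_mul_atTop hc)

lemma tendsto_exp_mul_theta₃_sub_one :
    Tendsto (fun t ↦ exp (π * t) * (theta₃ t - 1)) atTop (𝓝 2) := by
  simpa [theta₃] using tendsto_exp_mul_thetaMoment (k := 0) (by simp)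

lemma tendsto_theta₃ : Tendsto theta₃ atTop (𝓝 1) := by
  have h := ((tendsto_exp_neg_mul pi_pos).mul tendsto_exp_mul_theta₃_sub_one).add_const 1
  simp only [zero_mul, zero_add] at h
  refine h.congr fun t ↦ ?_
  rw [← mul_assoc, ← exp_add, neg_add_cancel, exp_zero]
  ring

lemma tendsto_theta₄ : Tendsto theta₄ atTop (𝓝 1) := by
  have h := ((tendsto_theta₃.comp (tendsto_id.const_mul_atTop (by norm_num : (0 : ℝ) < 4))
    ).const_mul 2).sub tendsto_theta₃
  norm_num at h
  exact h

lemma tendsto_exp_mul_theta₂ :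
    Tendsto (fun t ↦ exp (π / 4 * t) * theta₂ t) atTop (𝓝 2) := by
  have h := (tendsto_exp_mul_theta₃_sub_one.comp
    (tendsto_id.const_mul_atTop (by norm_num : (0 : ℝ) < 1 / 4))).sub
    ((tendsto_exp_neg_mul (by positivity : 0 < 3 * π / 4)).mul tendsto_exp_mul_theta₃_sub_one)
  simp only [zero_mul, sub_zero] at h
  refine h.congr fun t ↦ ?_
  rw [← mul_assoc, ← exp_add, theta₂]
  simp only [Function.comp_apply, id]
  ring_nf

lemma deriv_theta₃ {t : ℝ} (ht : 0 < t) : deriv theta₃ t = -π * thetaMoment 2 t :=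
  (hasDerivAt_thetaMoment 0 ht).deriv

lemma deriv_theta₄ {t : ℝ} (ht : 0 < t) :
    deriv theta₄ t = -π * (8 * thetaMoment 2 (4 * t) - thetaMoment 2 t) := by
  have h₁ : HasDerivAt (fun s ↦ theta₃ (4 * s)) (-π * thetaMoment 2 (4 * t) * 4) t :=
    (hasDerivAt_thetaMoment 0 (by positivity : 0 < 4 * t)).comp t
      (by simpa using (hasDerivAt_id t).const_mul 4)
  refine ((h₁.const_mul 2).sub (hasDerivAt_thetaMoment 0 ht)).deriv.trans ?_
  ring

lemma tendsto_exp_mul_thetaMoment_pos {k : ℕ} (hk : Even k) (hk₀ : k ≠ 0) :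
    Tendsto (fun t ↦ exp (π * t) * thetaMoment k t) atTop (𝓝 2) := by
  simpa [hk₀] using tendsto_exp_mul_thetaMoment hk

lemma tendsto_exp_mul_logDeriv_theta₃ :
    Tendsto (fun t ↦ exp (π * t) * logDeriv theta₃ t) atTop (𝓝 (-π * 2)) := by
  have h := ((tendsto_exp_mul_thetaMoment_pos (k := 2) (by simp) (by simp)).const_mul (-π)).div
    tendsto_theta₃ one_ne_zero
  rw [div_one] at h
  refine h.congr' ?_
  filter_upwards [eventually_gt_atTop 0] with t ht
  rw [logDeriv_apply, deriv_theta₃ ht, Pi.div_apply]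
  ring

lemma tendsto_exp_mul_logDeriv_theta₄ :
    Tendsto (fun t ↦ exp (π * t) * logDeriv theta₄ t) atTop (𝓝 (π * 2)) := by
  have h₂ := tendsto_exp_mul_thetaMoment_pos (k := 2) (by simp) (by simp)
  have h := ((((tendsto_exp_neg_mul (by positivity : 0 < 3 * π)).mul
    (h₂.comp (tendsto_id.const_mul_atTop (by norm_num : (0 : ℝ) < 4)))).const_mul 8).sub
      h₂).const_mul (-π) |>.div tendsto_theta₄ one_ne_zero
  rw [show -π * (8 * (0 * 2) - 2) / 1 = π * 2 by ring] at h
  refine h.congr' ?_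
  filter_upwards [eventually_gt_atTop 0] with t ht
  simp only [Function.comp_apply, id, ← mul_assoc, ← exp_add, logDeriv_apply, deriv_theta₄ ht,
    Pi.div_apply]
  ring_nf

lemma tendsto_comp_two_pow {f : ℝ → ℝ} {a t : ℝ} (ht : 0 < t) (hf : Tendsto f atTop (𝓝 a)) :
    Tendsto (fun n : ℕ ↦ f (2 ^ n * t)) atTop (𝓝 a) :=
  hf.comp ((tendsto_pow_atTop_atTop_of_one_lt one_lt_two).atTop_mul_const ht)

lemma eq_of_tendsto_of_two_mul {f : ℝ → ℝ} {a t : ℝ} (ht : 0 < t) (hf : Tendsto f atTop (𝓝 a))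
    (h : ∀ s, 0 < s → f (2 * s) = f s) : f t = a := by
  have h' (n : ℕ) : f (2 ^ n * t) = f t := by
    induction n with
    | zero => simp
    | succ n ih => rw [pow_succ', mul_assoc, h _ (by positivity), ih]
  simpa only [h', tendsto_const_nhds_iff] using tendsto_comp_two_pow ht hf

end asymptotics

section differential_equations

variable {t : ℝ}

lemma logDeriv_theta₃_sub_logDeriv_theta₄ (ht : 0 < t) :
    logDeriv theta₃ t - logDeriv theta₄ t = -π / 4 * theta₂ t ^ 4 := by
  rw [← div_eq_iff (pow_pos (theta₂_pos ht) 4).ne']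
  refine eq_of_tendsto_of_two_mul
    (f := fun t ↦ (logDeriv theta₃ t - logDeriv theta₄ t) / theta₂ t ^ 4) ht ?_
    fun s hs ↦ logDeriv_sub_div_theta₂_two_mul hs
  have h := (tendsto_exp_mul_logDeriv_theta₃.sub tendsto_exp_mul_logDeriv_theta₄).div
    (tendsto_exp_mul_theta₂.pow 4) (by norm_num)
  rw [show (-π * 2 - π * 2) / 2 ^ 4 = -π / 4 by ring] at h
  refine h.congr fun t ↦ ?_
  have : exp (π / 4 * t) ^ 4 = exp (π * t) := by
    rw [← exp_nat_mul]; push_cast; ring_nf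
  rw [Pi.div_apply, mul_pow, this, ← mul_sub, mul_div_mul_left _ _ (exp_pos _).ne']

lemma logDeriv_theta₂_sub_logDeriv_theta₃ (ht : 0 < t) :
    logDeriv theta₂ t - logDeriv theta₃ t = -π / 4 * theta₄ t ^ 4 := by
  have ht' := one_div_pos.mpr ht
  have hinv : HasDerivAt (fun s : ℝ ↦ 1 / s) (-(t ^ 2)⁻¹) t := by
    simpa only [one_div] using hasDerivAt_inv ht.ne'
  have h := HasDerivAt.eq_of_eqOn_Ioi ht
    ((hasDerivAt_theta₂ ht).mul ((hasDerivAt_theta₃ ht').comp t hinv))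
    ((hasDerivAt_theta₃ ht).mul ((hasDerivAt_theta₄ ht').comp t hinv)) fun s hs ↦ by
      simp only [Pi.mul_apply, Function.comp_apply, theta₃_one_div hs, theta₄_one_div hs]
      ring
  have hk := logDeriv_theta₃_sub_logDeriv_theta₄ ht'
  simp only [Function.comp_apply, theta₃_one_div ht, theta₄_one_div ht] at h
  rw [theta₂_one_div ht, mul_pow, show √t ^ 4 = t ^ 2 by
    rw [show √t ^ 4 = (√t ^ 2) ^ 2 by ring, sq_sqrt ht.le]] at hk
  field_simp at h
  have h' := mul_left_cancel₀ (mul_pos (theta₂_pos ht) (theta₃_pos ht)).ne' h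
  refine mul_left_cancel₀ (pow_pos ht 2).ne' ?_
  linear_combination h' + hk

lemma hasDerivAt_logDeriv_theta₃ (ht : 0 < t) :
    HasDerivAt (logDeriv theta₃)
      (π ^ 2 * thetaMoment 4 t / theta₃ t - logDeriv theta₃ t ^ 2) t := by
  have h := ((hasDerivAt_thetaMoment 2 ht).const_mul (-π)).div (hasDerivAt_thetaMoment 0 ht)
    (theta₃_pos ht).ne'
  refine (h.congr_of_eventuallyEq (eventually_of_mem (Ioi_mem_nhds ht) fun s hs ↦ ?_)
    ).congr_deriv ?_
  · rw [logDeriv_apply, deriv_theta₃ hs]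
    rfl
  · have := (theta₃_pos ht).ne'
    rw [logDeriv_apply, deriv_theta₃ ht]
    change (_ * thetaMoment 0 t - _) / thetaMoment 0 t ^ 2 =
      _ / thetaMoment 0 t - (_ / thetaMoment 0 t) ^ 2
    rw [theta₃] at this
    field_simp

lemma hasDerivAt_logDeriv_theta₄ (ht : 0 < t) :
    HasDerivAt (logDeriv theta₄) (deriv (logDeriv theta₃) t -
      4 * (logDeriv theta₃ t - logDeriv theta₄ t) * logDeriv theta₂ t) t := by
  have h := (hasDerivAt_logDeriv_theta₃ ht).differentiableAt.hasDerivAt.sub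
    (((hasDerivAt_theta₂ ht).pow 4).const_mul (-π / 4))
  refine (h.congr_of_eventuallyEq (eventually_of_mem (Ioi_mem_nhds ht) fun s hs ↦ ?_)
    ).congr_deriv ?_
  · simp only [Pi.sub_apply, Pi.pow_apply]
    linear_combination -logDeriv_theta₃_sub_logDeriv_theta₄ hs
  · rw [logDeriv_theta₃_sub_logDeriv_theta₄ ht]
    push_cast
    ring

lemma deriv_logDeriv_theta₄_two_mul (ht : 0 < t) :
    8 * deriv (logDeriv theta₄) (2 * t) =
      deriv (logDeriv theta₃) t + deriv (logDeriv theta₄) t := by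
  have h := HasDerivAt.eq_of_eqOn_Ioi ht
    ((hasDerivAt_logDeriv_theta₄ (by positivity : 0 < 2 * t)).comp_two_mul.const_mul 4)
    ((hasDerivAt_logDeriv_theta₃ ht).add (hasDerivAt_logDeriv_theta₄ ht))
    fun s hs ↦ logDeriv_theta₄_two_mul hs
  rw [(hasDerivAt_logDeriv_theta₄ (by positivity : 0 < 2 * t)).deriv,
    (hasDerivAt_logDeriv_theta₄ ht).deriv, (hasDerivAt_logDeriv_theta₃ ht).deriv] at *
  linear_combination h

/-- The defect in the Halphen differential equation for `logDeriv theta₃`. -/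
noncomputable def halphenDefect (t : ℝ) : ℝ :=
  deriv (logDeriv theta₃) t - 2 * logDeriv theta₃ t ^ 2 -
    π ^ 2 / 8 * theta₂ t ^ 4 * theta₄ t ^ 4

lemma halphenDefect_eq_theta₃ (ht : 0 < t) :
    halphenDefect t = deriv (logDeriv theta₃) t + 2 * (logDeriv theta₂ t * logDeriv theta₄ t -
      logDeriv theta₂ t * logDeriv theta₃ t - logDeriv theta₃ t * logDeriv theta₄ t) := by
  have h₁ := logDeriv_theta₃_sub_logDeriv_theta₄ ht
  have h₂ := logDeriv_theta₂_sub_logDeriv_theta₃ ht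
  rw [halphenDefect, eq_add_of_sub_eq' h₂, eq_sub_of_add_eq' (eq_add_of_sub_eq h₁).symm]
  ring

lemma halphenDefect_eq_theta₄ (ht : 0 < t) :
    halphenDefect t = deriv (logDeriv theta₄) t + 2 * (logDeriv theta₂ t * logDeriv theta₃ t -
      logDeriv theta₂ t * logDeriv theta₄ t - logDeriv theta₃ t * logDeriv theta₄ t) := by
  rw [halphenDefect_eq_theta₃ ht, (hasDerivAt_logDeriv_theta₄ ht).deriv]
  ring

lemma halphenDefect_two_mul (ht : 0 < t) : 4 * halphenDefect (2 * t) = halphenDefect t := by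
  have h2t : 0 < 2 * t := by positivity
  have hd := deriv_logDeriv_theta₄_two_mul ht
  have hsum := logDeriv_theta₂_two_mul_add ht
  have h₄ := logDeriv_theta₄_two_mul ht
  have h₁ := logDeriv_theta₃_sub_logDeriv_theta₄ ht
  have h₂ := logDeriv_theta₂_sub_logDeriv_theta₃ ht
  have hdiff : (logDeriv theta₂ (2 * t) - logDeriv theta₃ (2 * t)) ^ 2 =
      (logDeriv theta₂ t - logDeriv theta₄ t) * (logDeriv theta₂ t - logDeriv theta₃ t) := by
    have h : logDeriv theta₂ t - logDeriv theta₄ t = -π / 4 * theta₃ t ^ 4 := by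
      rw [theta₃_pow_four ht]; linear_combination h₁ + h₂
    rw [h, h₂, logDeriv_theta₂_sub_logDeriv_theta₃ h2t,
      show theta₄ (2 * t) ^ 4 = (theta₄ (2 * t) ^ 2) ^ 2 by ring, theta₄_two_mul_sq ht]
    ring
  have e₁ := halphenDefect_eq_theta₃ ht
  have e₂ := halphenDefect_eq_theta₄ ht
  rw [halphenDefect_eq_theta₄ h2t]
  have hprod : 4 * (logDeriv theta₂ (2 * t) * logDeriv theta₃ (2 * t)) =
      logDeriv theta₂ t ^ 2 -
        (logDeriv theta₂ t - logDeriv theta₄ t) * (logDeriv theta₂ t - logDeriv theta₃ t) := by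
    rw [← hdiff, ← hsum]; ring
  linear_combination hd / 2 + 2 * hprod - 8 * logDeriv theta₄ (2 * t) * hsum -
    2 * logDeriv theta₂ t * h₄ - e₁ / 2 - e₂ / 2

lemma tendsto_sq_mul_exp_neg_mul {c : ℝ} (hc : 0 < c) :
    Tendsto (fun t ↦ t ^ 2 * exp (-(c * t))) atTop (𝓝 0) := by
  simpa using tendsto_rpow_mul_exp_neg_mul_atTop_nhds_zero 2 c hc

lemma tendsto_sq_mul_halphenDefect :
    Tendsto (fun t ↦ t ^ 2 * halphenDefect t) atTop (𝓝 0) := by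
  have hM := (tendsto_exp_mul_thetaMoment_pos (k := 4) (by decide) (by simp)).const_mul
    (π ^ 2) |>.div tendsto_theta₃ one_ne_zero
  have hL := tendsto_exp_mul_logDeriv_theta₃
  have h := ((tendsto_sq_mul_exp_neg_mul pi_pos).mul (hM.sub
    (((tendsto_exp_neg_mul pi_pos).mul (hL.pow 2)).const_mul 3 |>.add
      ((tendsto_exp_mul_theta₂.pow 4).mul (tendsto_theta₄.pow 4) |>.const_mul (π ^ 2 / 8)))))
  rw [zero_mul] at h
  refine h.congr' ?_
  filter_upwards [eventually_gt_atTop 0] with t ht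
  rw [halphenDefect, (hasDerivAt_logDeriv_theta₃ ht).deriv]
  have e₁ : exp (-(π * t)) * exp (π * t) = 1 := by rw [← exp_add]; simp
  have e₂ : exp (π / 4 * t) ^ 4 = exp (π * t) := by
    rw [← exp_nat_mul]; push_cast; ring_nf
  simp only [Pi.div_apply, mul_pow, e₂]
  linear_combination (t ^ 2 * (π ^ 2 * thetaMoment 4 t / theta₃ t) -
    t ^ 2 * 3 * logDeriv theta₃ t ^ 2 * (1 + exp (-(π * t)) * exp (π * t)) -
    t ^ 2 * (π ^ 2 / 8) * theta₂ t ^ 4 * theta₄ t ^ 4) * e₁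

/-- The Halphen differential equation for `theta₃`. -/
lemma deriv_logDeriv_theta₃ (ht : 0 < t) :
    deriv (logDeriv theta₃) t =
      2 * logDeriv theta₃ t ^ 2 + π ^ 2 / 8 * theta₂ t ^ 4 * theta₄ t ^ 4 := by
  have h := eq_of_tendsto_of_two_mul ht tendsto_sq_mul_halphenDefect fun s hs ↦ by
    rw [← halphenDefect_two_mul hs]; ring
  have h' := (mul_eq_zero.mp h).resolve_left (pow_pos ht 2).ne'
  rw [halphenDefect] at h'
  linear_combination h'

end differential_equations

lemma theta₄_one : theta₄ 1 = theta₂ 1 := by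
  simpa using theta₄_one_div one_pos

lemma theta₃_one_pow_four : theta₃ 1 ^ 4 = 2 * theta₄ 1 ^ 4 := by
  rw [theta₃_pow_four one_pos, theta₄_one]
  ring

lemma fourth_cumulant_eq_theta₃_pow :
    thetaMoment 4 1 / theta₃ 1 - 3 * (thetaMoment 2 1 / theta₃ 1) ^ 2 = theta₃ 1 ^ 8 / 32 := by
  have h := deriv_logDeriv_theta₃ one_pos
  rw [(hasDerivAt_logDeriv_theta₃ one_pos).deriv, logDeriv_apply, deriv_theta₃ one_pos,
    ← theta₄_one] at h
  refine mul_left_cancel₀ (pow_pos pi_pos 2).ne' ?_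
  linear_combination h - π ^ 2 / 32 * (theta₃ 1 ^ 4 + 2 * theta₄ 1 ^ 4) * theta₃_one_pow_four

section agm

open MeasureTheory

/-- The complete elliptic integral in the form used by Gauss for the arithmetic-geometric mean. -/
noncomputable def agmIntegral (A B : ℝ) : ℝ := ∫ x : ℝ, 1 / √((x ^ 2 + A) * (x ^ 2 + B))

lemma agmIntegral_eq_integral_quartic {c q : ℝ} (hc : 0 < c) :
    agmIntegral q c = 2 * ∫ y in Ioi 0, 1 / √(y ^ 4 + (4 * q - 2 * c) * y ^ 2 + c ^ 2) := by
  set f : ℝ → ℝ := fun y ↦ (y - c * y⁻¹) / 2 with hf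
  have hderiv (y : ℝ) (hy : y ∈ Ioi (0 : ℝ)) :
      HasDerivWithinAt f ((1 + c / y ^ 2) / 2) (Ioi 0) y := by
    refine HasDerivAt.hasDerivWithinAt ?_
    refine (((hasDerivAt_id' y).sub ((hasDerivAt_inv (ne_of_gt hy)).const_mul c)).div_const
      2).congr_deriv ?_
    ring
  have hinj : InjOn f (Ioi 0) := by
    intro x hx y hy hxy
    have hx' : 0 < x := hx
    have hy' : 0 < y := hy
    simp only [hf] at hxy
    field_simp at hxy
    have : (x - y) * (x * y + c) = 0 := by linear_combination hxy
    exact sub_eq_zero.mp ((mul_eq_zero.mp this).resolve_right (by positivity))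
  have himage : f '' Ioi 0 = univ := by
    refine eq_univ_of_forall fun x ↦ ⟨x + √(x ^ 2 + c), ?_, ?_⟩
    · have h : |x| < √(x ^ 2 + c) := by
        rw [← sqrt_sq_eq_abs]
        exact sqrt_lt_sqrt (sq_nonneg x) (by linarith)
      have := neg_abs_le x
      simp only [mem_Ioi]
      linarith
    · have h : |x| < √(x ^ 2 + c) := by
        rw [← sqrt_sq_eq_abs]
        exact sqrt_lt_sqrt (sq_nonneg x) (by linarith)
      have hpos : 0 < x + √(x ^ 2 + c) := by linarith [neg_abs_le x]
      simp only [hf]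
      field_simp
      linear_combination sq_sqrt (by positivity : 0 ≤ x ^ 2 + c)
  have h := integral_image_eq_integral_abs_deriv_smul measurableSet_Ioi hderiv hinj
    fun x ↦ 1 / √((x ^ 2 + q) * (x ^ 2 + c))
  rw [himage, setIntegral_univ] at h
  rw [agmIntegral, h, ← integral_const_mul]
  refine setIntegral_congr_fun measurableSet_Ioi fun y hy ↦ ?_
  have hy : 0 < y := hy
  have hsq : (f y ^ 2 + q) * (f y ^ 2 + c) =
      ((y ^ 2 + c) / (4 * y ^ 2)) ^ 2 * (y ^ 4 + (4 * q - 2 * c) * y ^ 2 + c ^ 2) := by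
    simp only [hf]
    field_simp
    ring
  rw [hsq, sqrt_mul (sq_nonneg _), sqrt_sq (by positivity), smul_eq_mul,
    abs_of_pos (by positivity), one_div, one_div, mul_inv, ← mul_assoc]
  congr 1
  field_simp
  ring

lemma agmIntegral_step {a b : ℝ} (ha : 0 < a) (hb : 0 < b) :
    agmIntegral (((a + b) / 2) ^ 2) (a * b) = agmIntegral (a ^ 2) (b ^ 2) := by
  rw [agmIntegral_eq_integral_quartic (mul_pos ha hb), agmIntegral,
    ← integral_comp_abs (f := fun y ↦ 1 / √(y ^ 4 + (4 * ((a + b) / 2) ^ 2 - 2 * (a * b)) * y ^ 2 +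
      (a * b) ^ 2))]
  refine integral_congr_ae (.of_forall fun y ↦ ?_)
  have h4 : |y| ^ 4 = y ^ 4 := Even.pow_abs (by decide) y
  dsimp only
  rw [sq_abs, h4]
  ring_nf

lemma inv_sq_add_sq_eq {b : ℝ} (hb : 0 < b) :
    (fun x : ℝ ↦ 1 / (x ^ 2 + b ^ 2)) = fun x ↦ (b ^ 2)⁻¹ * (1 + (b⁻¹ * x) ^ 2)⁻¹ := by
  ext x
  field_simp
  ring

lemma integrable_one_div_sq_add_sq {b : ℝ} (hb : 0 < b) :
    Integrable fun x : ℝ ↦ 1 / (x ^ 2 + b ^ 2) := by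
  rw [inv_sq_add_sq_eq hb]
  exact (integrable_inv_one_add_sq.comp_mul_left' (inv_pos.mpr hb).ne').const_mul _

lemma integral_one_div_sq_add_sq {b : ℝ} (hb : 0 < b) :
    ∫ x : ℝ, 1 / (x ^ 2 + b ^ 2) = π / b := by
  rw [inv_sq_add_sq_eq hb, integral_const_mul,
    Measure.integral_comp_mul_left (fun x ↦ (1 + x ^ 2)⁻¹) b⁻¹, integral_univ_inv_one_add_sq,
    inv_inv, abs_of_pos hb, smul_eq_mul]
  field_simp

lemma agmIntegral_bounds {a b : ℝ} (hb : 0 < b) (hba : b ≤ a) :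
    π / a ≤ agmIntegral (a ^ 2) (b ^ 2) ∧ agmIntegral (a ^ 2) (b ^ 2) ≤ π / b := by
  have ha : 0 < a := hb.trans_le hba
  have hsq : b ^ 2 ≤ a ^ 2 := by gcongr
  have hlower (x : ℝ) : 1 / (x ^ 2 + a ^ 2) ≤ 1 / √((x ^ 2 + a ^ 2) * (x ^ 2 + b ^ 2)) := by
    refine one_div_le_one_div_of_le (by positivity) ?_
    rw [sqrt_le_left (by positivity), sq (x ^ 2 + a ^ 2)]
    gcongr
  have hupper (x : ℝ) : 1 / √((x ^ 2 + a ^ 2) * (x ^ 2 + b ^ 2)) ≤ 1 / (x ^ 2 + b ^ 2) := by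
    refine one_div_le_one_div_of_le (by positivity) ?_
    refine le_sqrt_of_sq_le ?_
    rw [sq (x ^ 2 + b ^ 2)]
    gcongr
  have hint : Integrable fun x : ℝ ↦ 1 / √((x ^ 2 + a ^ 2) * (x ^ 2 + b ^ 2)) := by
    refine (integrable_one_div_sq_add_sq hb).mono' ?_ (.of_forall fun x ↦ ?_)
    · exact Measurable.aestronglyMeasurable (by fun_prop)
    · rw [norm_of_nonneg (by positivity)]
      exact hupper x
  rw [← integral_one_div_sq_add_sq ha, ← integral_one_div_sq_add_sq hb]
  exact ⟨integral_mono (integrable_one_div_sq_add_sq ha) hint hlower,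
    integral_mono hint (integrable_one_div_sq_add_sq hb) hupper⟩

/-- The elliptic integral is constant along the theta parametrization of the iteration. -/
lemma agmIntegral_theta {t : ℝ} (ht : 0 < t) :
    agmIntegral ((theta₃ t ^ 2) ^ 2) ((theta₄ t ^ 2) ^ 2) = π := by
  refine eq_of_tendsto_of_two_mul
    (f := fun t ↦ agmIntegral ((theta₃ t ^ 2) ^ 2) ((theta₄ t ^ 2) ^ 2)) ht ?_ fun s hs ↦ ?_
  · have h₃ := (tendsto_const_nhds (x := π)).div (tendsto_theta₃.pow 2) (by norm_num)
    have h₄ := (tendsto_const_nhds (x := π)).div (tendsto_theta₄.pow 2) (by norm_num)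
    rw [one_pow, div_one] at h₃ h₄
    have hb : ∀ᶠ s in atTop, π / theta₃ s ^ 2 ≤
        agmIntegral ((theta₃ s ^ 2) ^ 2) ((theta₄ s ^ 2) ^ 2) ∧
        agmIntegral ((theta₃ s ^ 2) ^ 2) ((theta₄ s ^ 2) ^ 2) ≤ π / theta₄ s ^ 2 := by
      filter_upwards [eventually_gt_atTop 0] with s hs
      exact agmIntegral_bounds (pow_pos (theta₄_pos hs) 2)
        (pow_le_pow_left₀ (theta₄_pos hs).le (theta₄_lt_theta₃ hs).le 2)
    exact tendsto_of_tendsto_of_tendsto_of_le_of_le' h₃ h₄ (hb.mono fun _ h ↦ h.1)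
      (hb.mono fun _ h ↦ h.2)
  · rw [← agmIntegral_step (pow_pos (theta₃_pos hs) 2) (pow_pos (theta₄_pos hs) 2),
      theta₃_sq_add_theta₄_sq hs, theta₄_two_mul_sq hs]
    ring_nf

lemma integral_exp_neg_mul_pow_four {b : ℝ} (hb : 0 < b) :
    ∫ y in Ioi 0, exp (-b * y ^ 4) = b ^ (-(1 / 4) : ℝ) * (1 / 4) * Gamma (1 / 4) := by
  have h := integral_rpow_mul_exp_neg_mul_rpow (p := 4) (q := 0) (by norm_num) (by norm_num) hb
  norm_num at h ⊢
  exact h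

lemma integrable_exp_neg_mul_pow_four {b : ℝ} (hb : 0 < b) :
    IntegrableOn (fun y ↦ exp (-b * y ^ 4)) (Ioi 0) := by
  have h := integrableOn_rpow_mul_exp_neg_mul_rpow (p := 4) (s := 0) (by norm_num) (by norm_num) hb
  norm_num at h ⊢
  exact h

lemma integral_exp_neg_pow_four_add_mul_sq (d : ℝ) {x : ℝ} (hx : 0 < x) :
    ∫ y in Ioi 0, exp (-(y ^ 4 + d ^ 2) * x ^ 2) =
      Gamma (1 / 4) / 4 * (x ^ (-(1 / 2) : ℝ) * exp (-d ^ 2 * x ^ 2)) := by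
  have h (y : ℝ) : exp (-(y ^ 4 + d ^ 2) * x ^ 2) =
      exp (-d ^ 2 * x ^ 2) * exp (-x ^ 2 * y ^ 4) := by
    rw [← exp_add]
    ring_nf
  have hpow : (x ^ 2) ^ (-(1 / 4) : ℝ) = x ^ (-(1 / 2) : ℝ) := by
    rw [← rpow_natCast_mul hx.le]
    norm_num
  simp only [h]
  rw [integral_const_mul, integral_exp_neg_mul_pow_four (pow_pos hx 2), hpow]
  ring

lemma integrable_exp_neg_pow_four_add_mul_sq {d : ℝ} (hd : 0 < d) :
    Integrable (fun p : ℝ × ℝ ↦ exp (-(p.1 ^ 4 + d ^ 2) * p.2 ^ 2))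
      ((volume.restrict (Ioi 0)).prod (volume.restrict (Ioi 0))) := by
  rw [integrable_prod_iff' (Continuous.aestronglyMeasurable (by fun_prop))]
  constructor
  · refine (ae_restrict_mem measurableSet_Ioi).mono fun x hx ↦ ?_
    refine ((integrable_exp_neg_mul_pow_four (pow_pos hx 2)).const_mul
      (exp (-d ^ 2 * x ^ 2))).congr (.of_forall fun y ↦ ?_)
    simp only [← exp_add]
    ring_nf
  · refine ((integrableOn_rpow_mul_exp_neg_mul_sq (b := d ^ 2) (s := -(1 / 2)) (pow_pos hd 2)
      (by norm_num)).const_mul (Gamma (1 / 4) / 4)).congr ?_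
    refine (ae_restrict_mem measurableSet_Ioi).mono fun x hx ↦ ?_
    simp only [norm_of_nonneg (exp_pos _).le]
    exact (integral_exp_neg_pow_four_add_mul_sq d hx).symm

/-- The complete lemniscatic integral. -/
lemma integral_one_div_sqrt_pow_four_add_sq {d : ℝ} (hd : 0 < d) :
    ∫ y in Ioi 0, 1 / √(y ^ 4 + d ^ 2) = Gamma (1 / 4) ^ 2 / (4 * √π * √d) := by
  have hgauss (y : ℝ) : 1 / √(y ^ 4 + d ^ 2) =
      2 / √π * ∫ x in Ioi 0, exp (-(y ^ 4 + d ^ 2) * x ^ 2) := by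
    rw [integral_gaussian_Ioi, sqrt_div pi_pos.le]
    field_simp
  have hpow : (d ^ 2) ^ (-(1 / 4) : ℝ) = (√d)⁻¹ := by
    rw [sqrt_eq_rpow, ← rpow_neg hd.le, ← rpow_natCast_mul hd.le]
    norm_num
  have hmellin : ∫ x in Ioi 0, x ^ (-(1 / 2) : ℝ) * exp (-d ^ 2 * x ^ 2) =
      (√d)⁻¹ * (1 / 2) * Gamma (1 / 4) := by
    have h := integral_rpow_mul_exp_neg_mul_rpow (p := 2) (q := -(1 / 2)) (by norm_num)
      (by norm_num) (pow_pos hd 2)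
    rw [show -(-(1 / 2) + 1 : ℝ) / 2 = -(1 / 4) by norm_num,
      show (-(1 / 2) + 1 : ℝ) / 2 = 1 / 4 by norm_num, hpow] at h
    simpa only [rpow_two] using h
  simp only [hgauss]
  rw [integral_const_mul, integral_integral_swap (integrable_exp_neg_pow_four_add_mul_sq hd),
    setIntegral_congr_fun measurableSet_Ioi fun x hx ↦
      integral_exp_neg_pow_four_add_mul_sq d hx, integral_const_mul, hmellin]
  field_simp

lemma theta₃_one_sq : theta₃ 1 ^ 2 = Gamma (1 / 4) ^ 2 / (2 * √π * π) := by
  have hA : 0 < theta₃ 1 ^ 4 := pow_pos (theta₃_pos one_pos) 4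
  have h := agmIntegral_theta one_pos
  have hswap : agmIntegral ((theta₃ 1 ^ 2) ^ 2) ((theta₄ 1 ^ 2) ^ 2) =
      agmIntegral (theta₃ 1 ^ 4 / 2) (theta₃ 1 ^ 4) := by
    simp only [agmIntegral]
    congr! 4 with x
    rw [mul_comm]
    linear_combination (-(x ^ 2 + theta₃ 1 ^ 4) / 2) * theta₃_one_pow_four
  rw [hswap, agmIntegral_eq_integral_quartic hA] at h
  have h0 : 4 * (theta₃ 1 ^ 4 / 2) - 2 * theta₃ 1 ^ 4 = 0 := by ring
  simp only [h0, zero_mul, add_zero] at h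
  rw [integral_one_div_sqrt_pow_four_add_sq hA,
    show theta₃ 1 ^ 4 = (theta₃ 1 ^ 2) ^ 2 by ring, sqrt_sq (sq_nonneg _)] at h
  have := theta₃_pos one_pos
  field_simp at h ⊢
  linear_combination -h / 2

end agm

/-- The fourth cumulant of the discrete normal distribution with `q = e^{-π}`:
`μ₄ − 3μ₂² = Γ(1/4)⁸/(2⁹ π⁶)`. -/
theorem theta3_fourth_cumulant :
    (∑' p : ℤ, (p : ℝ) ^ 4 * Real.exp (-π * (p : ℝ) ^ 2)) /
        (∑' p : ℤ, Real.exp (-π * (p : ℝ) ^ 2)) -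
      3 * ((∑' p : ℤ, (p : ℝ) ^ 2 * Real.exp (-π * (p : ℝ) ^ 2)) /
        (∑' p : ℤ, Real.exp (-π * (p : ℝ) ^ 2))) ^ 2 =
      (Real.Gamma (1 / 4)) ^ 8 / (2 ^ 9 * π ^ 6) := by
  have h := fourth_cumulant_eq_theta₃_pow
  rw [show theta₃ 1 ^ 8 = (theta₃ 1 ^ 2) ^ 4 by ring, theta₃_one_sq] at h
  simp only [theta₃, thetaMoment, mul_one, pow_zero, one_mul] at h
  rw [h]
  have hπ : √π ^ 4 = π ^ 2 := by
    rw [show √π ^ 4 = (√π ^ 2) ^ 2 by ring, sq_sqrt pi_pos.le]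
  rw [div_pow, mul_pow, mul_pow, hπ]
  field_simp
  norm_num
end

section
/- Mittag-Leffler expansion of tanh: for all real x, tanh(πx) = (8x/π) ∑_{m≥1} 1/((2m−1)² + 4x²). -/
open Real

theorem summable_one_div_sq_add_succ_sq (y : ℝ) :
    Summable fun n : ℕ ↦ 1 / (y ^ 2 + ((n : ℝ) + 1) ^ 2) := by
  have h : Summable fun n : ℕ ↦ 1 / ((n : ℝ) + 1) ^ 2 := by
    simpa using (summable_nat_add_iff 1).2 (Real.summable_one_div_nat_pow.2 one_lt_two)
  refine h.of_nonneg_of_le (fun n ↦ by positivity) fun n ↦ ?_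
  gcongr
  nlinarith [sq_nonneg y]

/-- Mittag-Leffler expansion of the hyperbolic cotangent. -/
theorem pi_mul_cosh_div_sinh_eq_tsum {y : ℝ} (hy : y ≠ 0) :
    π * (cosh (π * y) / sinh (π * y)) =
      1 / y + 2 * y * ∑' n : ℕ, 1 / (y ^ 2 + ((n : ℝ) + 1) ^ 2) := by
  have hz : (y * Complex.I : ℂ) ∈ Complex.integerComplement := by
    rintro ⟨n, hn⟩
    simpa [hy, eq_comm] using congrArg Complex.im hn
  have h := cot_series_rep' hz
  have hterm (n : ℕ) : (1 / (y * Complex.I - (n + 1)) + 1 / (y * Complex.I + (n + 1)) : ℂ) =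
      -Complex.I * (2 * y) * ((1 / (y ^ 2 + ((n : ℝ) + 1) ^ 2) : ℝ) : ℂ) := by
    have hn : (n : ℝ) + 1 ≠ 0 := by positivity
    have h₁ : (y * Complex.I - (n + 1) : ℂ) ≠ 0 := fun h ↦ hy (by
      simpa using congrArg Complex.im h)
    have h₂ : (y * Complex.I + (n + 1) : ℂ) ≠ 0 := fun h ↦ hy (by
      simpa using congrArg Complex.im h)
    have h₃ : (y ^ 2 + ((n : ℂ) + 1) ^ 2 : ℂ) ≠ 0 := by
      have : y ^ 2 + ((n : ℝ) + 1) ^ 2 ≠ 0 := by positivity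
      exact_mod_cast this
    push_cast
    rw [div_add_div _ _ h₁ h₂, mul_one_div, div_eq_div_iff (mul_ne_zero h₁ h₂) h₃]
    linear_combination 2 * (y : ℂ) ^ 3 * Complex.I * Complex.I_sq
  simp_rw [hterm] at h
  rw [tsum_mul_left, ← Complex.ofReal_tsum, Complex.cot, ← mul_assoc, Complex.cos_mul_I,
    Complex.sin_mul_I] at h
  have hs : sinh (π * y) ≠ 0 := by simp [hy, pi_ne_zero]
  have hsC : Complex.sinh (π * y) ≠ 0 := by exact_mod_cast hs
  have hyC : (y : ℂ) ≠ 0 := by exact_mod_cast hy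
  apply Complex.ofReal_injective
  set S := ∑' n : ℕ, 1 / (y ^ 2 + ((n : ℝ) + 1) ^ 2)
  push_cast
  have e : (π * (Complex.cosh (π * y) / (Complex.sinh (π * y) * Complex.I)) -
      1 / (y * Complex.I) : ℂ) =
      -Complex.I * (π * (Complex.cosh (π * y) / Complex.sinh (π * y)) - 1 / y) := by
    rw [← div_div, ← div_div, Complex.div_I, Complex.div_I]
    ring
  rw [e, mul_assoc] at h
  have h' := mul_left_cancel₀ (neg_ne_zero.2 Complex.I_ne_zero) h
  linear_combination h'

/-- Mittag-Leffler expansion of `tanh`. -/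
theorem tanh_mittag_leffler (x : ℝ) :
    Real.tanh (π * x) =
      (8 * x / π) * ∑' m : ℕ, 1 / ((2 * (m : ℝ) + 1) ^ 2 + 4 * x ^ 2) := by
  rcases eq_or_ne x 0 with rfl | hx
  · simp
  have h₁ := pi_mul_cosh_div_sinh_eq_tsum hx
  have h₂ := pi_mul_cosh_div_sinh_eq_tsum (y := 2 * x) (by positivity)
  have hsum := summable_one_div_sq_add_succ_sq (2 * x)
  have hsplit := tsum_even_add_odd (f := fun n : ℕ ↦ 1 / ((2 * x) ^ 2 + ((n : ℝ) + 1) ^ 2))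
    (hsum.comp_injective (i := fun k : ℕ ↦ 2 * k) fun a b h ↦ by simpa using h)
    (hsum.comp_injective (i := fun k : ℕ ↦ 2 * k + 1) fun a b h ↦ by simpa using h)
  have heven (k : ℕ) : 1 / ((2 * x) ^ 2 + (((2 * k : ℕ) : ℝ) + 1) ^ 2) =
      1 / ((2 * (k : ℝ) + 1) ^ 2 + 4 * x ^ 2) := by
    push_cast
    ring_nf
  have hodd (k : ℕ) : 1 / ((2 * x) ^ 2 + (((2 * k + 1 : ℕ) : ℝ) + 1) ^ 2) =
      1 / 4 * (1 / (x ^ 2 + ((k : ℝ) + 1) ^ 2)) := by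
    rw [one_div_mul_one_div]
    push_cast
    ring_nf
  simp only [heven, hodd] at hsplit
  rw [tsum_mul_left] at hsplit
  rw [← hsplit, show π * (2 * x) = 2 * (π * x) by ring, cosh_two_mul, sinh_two_mul] at h₂
  have hs : sinh (π * x) ≠ 0 := by simp [hx, pi_ne_zero]
  have hc : cosh (π * x) ≠ 0 := (cosh_pos _).ne'
  have key : π * tanh (π * x) =
      2 * (π * ((cosh (π * x) ^ 2 + sinh (π * x) ^ 2) / (2 * sinh (π * x) * cosh (π * x)))) -
        π * (cosh (π * x) / sinh (π * x)) := by
    rw [tanh_eq_sinh_div_cosh]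
    field_simp
    ring
  have hx' : 2 * (1 / (2 * x)) = 1 / x := by field_simp
  rw [h₁, h₂, mul_add, hx'] at key
  rw [div_mul_eq_mul_div, eq_div_iff pi_ne_zero]
  linear_combination key
end
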